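/- arXiv:1311.5966 — 2 statements merged into one kernel-verified Lean document; each statement's English description precedes it below -/
import Mathlib

section
/- Assume Conditions 2 and 3. Then there exist α, β ∈ [0,1] and t_α, t_β, t₁ ∈ ℝ such that the function u(x,y) = max(0, x + α·y − t_α, β·x + y − t_β, x + y − t₁) is an optimal feasible utility function; that is, the optimal mechanism has at most 4 menu items: (0,0,0), (1,α,t_α), (β,1,t_β) and (1,1,t₁). -/
open MeasureTheory Set

noncomputable section

/-- A positive, bounded, differentiable density on `[a,b]` integrating to 1. -/
def Density (a b : ℝ) (h : ℝ → ℝ) : Prop :=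
  (∀ x ∈ Set.Icc a b, 0 < h x) ∧ (∃ M, ∀ x ∈ Set.Icc a b, h x ≤ M) ∧
  (∀ x ∈ Set.Icc a b, DifferentiableAt ℝ h x) ∧ (∫ x in a..b, h x) = 1

/-- The valuation rectangle `V = [xA,xB] × [yA,yC]`. -/
def V (xA xB yA yC : ℝ) : Set (ℝ × ℝ) := Set.Icc (xA, yA) (xB, yC)

/-- First partial derivative. -/
def pd1 (u : ℝ × ℝ → ℝ) (z : ℝ × ℝ) : ℝ := fderiv ℝ u z (1, 0)

/-- Second partial derivative. -/
def pd2 (u : ℝ × ℝ → ℝ) (z : ℝ × ℝ) : ℝ := fderiv ℝ u z (0, 1)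

/-- A feasible buyer utility function: nonnegative, convex, with increments in each
coordinate between `0` and the coordinate increment (partial derivatives in `[0,1]`). -/
def Feasible (xA xB yA yC : ℝ) (u : ℝ × ℝ → ℝ) : Prop :=
  (∀ z ∈ V xA xB yA yC, 0 ≤ u z) ∧
  ConvexOn ℝ (V xA xB yA yC) u ∧
  (∀ x x' y, xA ≤ x → x ≤ x' → x' ≤ xB → y ∈ Set.Icc yA yC →
    0 ≤ u (x', y) - u (x, y) ∧ u (x', y) - u (x, y) ≤ x' - x) ∧
  (∀ x y y', x ∈ Set.Icc xA xB → yA ≤ y → y ≤ y' → y' ≤ yC →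
    0 ≤ u (x, y') - u (x, y) ∧ u (x, y') - u (x, y) ≤ y' - y)

/-- The seller's expected revenue from utility function `u` under joint density
`f₁(x)·f₂(y)`. -/
def Rev (xA xB yA yC : ℝ) (f1 f2 : ℝ → ℝ) (u : ℝ × ℝ → ℝ) : ℝ :=
  ∫ z in V xA xB yA yC, (z.1 * pd1 u z + z.2 * pd2 u z - u z) * (f1 z.1 * f2 z.2)

/-- The optimal revenue: supremum of revenue over feasible utility functions. -/
def OptRev (xA xB yA yC : ℝ) (f1 f2 : ℝ → ℝ) : ℝ :=
  sSup {r | ∃ u, Feasible xA xB yA yC u ∧ r = Rev xA xB yA yC f1 f2 u}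

/-- A feasible utility function is optimal if its revenue attains the supremum. -/
def Optimal (xA xB yA yC : ℝ) (f1 f2 : ℝ → ℝ) (u : ℝ × ℝ → ℝ) : Prop :=
  Feasible xA xB yA yC u ∧ Rev xA xB yA yC f1 f2 u = OptRev xA xB yA yC f1 f2

/-- The power rate of a density `h`: `PR(h)(x) = x·h'(x)/h(x)`. -/
def PR (h : ℝ → ℝ) (x : ℝ) : ℝ := x * deriv h x / h x

/-- The bundling revenue `BRev = sup_{p ≥ 0} p · ∫_{x+y ≥ p} f`. -/
def BRev (xA xB yA yC : ℝ) (f1 f2 : ℝ → ℝ) : ℝ :=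
  sSup {r | ∃ p, 0 ≤ p ∧
    r = p * ∫ z in {z ∈ V xA xB yA yC | p ≤ z.1 + z.2}, f1 z.1 * f2 z.2}

/-- The payment associated with utility `u` at a point of differentiability. -/
def pay (u : ℝ × ℝ → ℝ) (z : ℝ × ℝ) : ℝ := pd1 u z * z.1 + pd2 u z * z.2 - u z

/-- One coordinate of the problem: a density `f` on `[p, q]` together with the weights `a` and `b`
that the virtual value measure puts on the upper and the lower end of each ray. -/
structure Side where
  p : ℝ
  q : ℝ
  a : ℝ
  b : ℝ
  f : ℝ → ℝ
  lt : p < q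
  a_nonneg : 0 ≤ a
  b_nonneg : 0 ≤ b
  cont : Continuous f
  nonneg : ∀ x, 0 ≤ f x
  mass : ∫ x in p..q, f x = 1

namespace Side

/-- The virtual value of a function `E` along a ray. -/
def ray (S : Side) (D : ℝ) (E : ℝ → ℝ) : ℝ :=
  S.a * E S.q - S.b * E S.p - D * ∫ x in S.p..S.q, S.f x * E x

/-- Monotone functions vanishing on `[p, l]` have nonnegative virtual value. -/
def Upper (S : Side) (D l : ℝ) : Prop :=
  ∀ E : ℝ → ℝ, Continuous E → MonotoneOn E (Icc S.p S.q) → (∀ x ∈ Icc S.p S.q, 0 ≤ E x) →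
    (∀ x ∈ Icc S.p S.q, x ≤ l → E x = 0) → 0 ≤ S.ray D E

/-- Nonnegative monotone functions constant on `[l, q]` have nonpositive virtual value. -/
def Lower (S : Side) (D l : ℝ) : Prop :=
  ∀ E : ℝ → ℝ, Continuous E → MonotoneOn E (Icc S.p S.q) → (∀ x ∈ Icc S.p S.q, 0 ≤ E x) →
    (∀ x ∈ Icc S.p S.q, l ≤ x → E x = E S.q) → S.ray D E ≤ 0

variable (S : Side) {D : ℝ}

lemma left_mem : S.p ∈ Icc S.p S.q := ⟨le_rfl, S.lt.le⟩

lemma right_mem : S.q ∈ Icc S.p S.q := ⟨S.lt.le, le_rfl⟩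

lemma ray_sub {E E' : ℝ → ℝ} (hE : Continuous E) (hE' : Continuous E') :
    S.ray D (fun x => E' x - E x) = S.ray D E' - S.ray D E := by
  have h : ∫ x in S.p..S.q, S.f x * (E' x - E x)
      = (∫ x in S.p..S.q, S.f x * E' x) - ∫ x in S.p..S.q, S.f x * E x := by
    have hS := S.cont
    rw [← intervalIntegral.integral_sub (Continuous.intervalIntegrable (by fun_prop) _ _)
      (Continuous.intervalIntegrable (by fun_prop) _ _)]
    simp only [mul_sub]
  simp only [ray, h]
  ring

lemma ray_le_of_eq_right {E E' : ℝ → ℝ} (hD : 0 ≤ D) (hE : Continuous E) (hE' : Continuous E')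
    (h : ∀ x ∈ Icc S.p S.q, E x ≤ E' x) (hq : E S.q = E' S.q) : S.ray D E' ≤ S.ray D E := by
  have hi : ∫ x in S.p..S.q, S.f x * E x ≤ ∫ x in S.p..S.q, S.f x * E' x :=
    intervalIntegral.integral_mono_on S.lt.le ((S.cont.mul hE).intervalIntegrable _ _)
      ((S.cont.mul hE').intervalIntegrable _ _)
      fun x hx => mul_le_mul_of_nonneg_left (h x hx) (S.nonneg x)
  have hp := mul_le_mul_of_nonneg_left (h _ S.left_mem) S.b_nonneg
  have hd := mul_le_mul_of_nonneg_left hi hD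
  simp only [ray, hq]
  linarith

lemma upper_of_nonneg (hD : 0 ≤ D) {l : ℝ} (hl : l ∈ Icc S.p S.q)
    (h : 0 ≤ S.a - D * ∫ x in l..S.q, S.f x) : S.Upper D l := by
  intro E hE hm _ hz
  have hi : ∀ u v, IntervalIntegrable (fun x => S.f x * E x) volume u v :=
    fun u v => (S.cont.mul hE).intervalIntegrable u v
  have h1 : ∫ x in S.p..S.q, S.f x * E x ≤ E S.q * ∫ x in l..S.q, S.f x := by
    rw [← intervalIntegral.integral_add_adjacent_intervals (hi S.p l) (hi l S.q),
      ← intervalIntegral.integral_const_mul]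
    have : ∫ x in S.p..l, S.f x * E x = 0 := by
      rw [intervalIntegral.integral_congr (g := fun _ => 0), intervalIntegral.integral_zero]
      intro x hx
      rw [uIcc_of_le hl.1] at hx
      simp [hz x ⟨hx.1, hx.2.trans hl.2⟩ hx.2]
    rw [this, zero_add]
    refine intervalIntegral.integral_mono_on hl.2 (hi _ _)
      ((S.cont.const_mul _).intervalIntegrable _ _) fun x hx => ?_
    rw [mul_comm]
    exact mul_le_mul_of_nonneg_right
      (hm ⟨hl.1.trans hx.1, hx.2⟩ S.right_mem hx.2) (S.nonneg x)
  have h2 : 0 ≤ E S.q := by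
    rw [← hz S.p S.left_mem hl.1]; exact hm S.left_mem S.right_mem S.lt.le
  have h3 := mul_le_mul_of_nonneg_left h1 hD
  have h4 := mul_nonneg h2 h
  simp only [ray, hz S.p S.left_mem hl.1]
  linarith

lemma lower_of_nonpos (hD : 0 ≤ D) {l : ℝ} (hl : l ∈ Icc S.p S.q)
    (h : S.a - D * (∫ x in l..S.q, S.f x) ≤ 0) : S.Lower D l := by
  intro E hE hm h0 hz
  have hi : ∀ u v, IntervalIntegrable (fun x => S.f x * E x) volume u v :=
    fun u v => (S.cont.mul hE).intervalIntegrable u v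
  have h1 : E S.q * (∫ x in l..S.q, S.f x) ≤ ∫ x in S.p..S.q, S.f x * E x := by
    rw [← intervalIntegral.integral_add_adjacent_intervals (hi S.p l) (hi l S.q),
      ← intervalIntegral.integral_const_mul]
    have h5 : 0 ≤ ∫ x in S.p..l, S.f x * E x :=
      intervalIntegral.integral_nonneg hl.1 fun x hx =>
        mul_nonneg (S.nonneg x) (h0 x ⟨hx.1, hx.2.trans hl.2⟩)
    have h6 : ∫ x in l..S.q, S.f x * E x = ∫ x in l..S.q, E S.q * S.f x := by
      refine intervalIntegral.integral_congr fun x hx => ?_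
      rw [uIcc_of_le hl.2] at hx
      simp only [hz x ⟨hl.1.trans hx.1, hx.2⟩ hx.1]
      ring
    linarith
  have h2 := mul_le_mul_of_nonneg_left h1 hD
  have h3 := mul_nonneg S.b_nonneg (h0 _ S.left_mem)
  have h4 := mul_nonneg (h0 _ S.right_mem) (neg_nonneg.2 h)
  simp only [ray]
  linarith

lemma upper_below (hD : 0 ≤ D) (h : 0 ≤ S.a - S.b - D) : S.Upper D (S.p - 1) := by
  intro E hE hm h0 _
  have h1 : ∫ x in S.p..S.q, S.f x * E x ≤ E S.q := by
    calc ∫ x in S.p..S.q, S.f x * E x ≤ ∫ x in S.p..S.q, S.f x * E S.q :=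
          intervalIntegral.integral_mono_on S.lt.le ((S.cont.mul hE).intervalIntegrable _ _)
            ((S.cont.mul continuous_const).intervalIntegrable _ _)
            fun x hx => mul_le_mul_of_nonneg_left (hm hx S.right_mem hx.2) (S.nonneg x)
      _ = E S.q := by rw [intervalIntegral.integral_mul_const, S.mass, one_mul]
  have h2 := mul_le_mul_of_nonneg_left h1 hD
  have h3 := mul_le_mul_of_nonneg_left (hm S.left_mem S.right_mem S.lt.le) S.b_nonneg
  have h4 := mul_nonneg (h0 _ S.right_mem) h
  simp only [ray]
  linarith

lemma lower_left (h : S.a - S.b - D ≤ 0) : S.Lower D S.p := by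
  intro E _ _ h0 hz
  have h1 : ∫ x in S.p..S.q, S.f x * E x = E S.q := by
    calc ∫ x in S.p..S.q, S.f x * E x = ∫ x in S.p..S.q, S.f x * E S.q := by
          refine intervalIntegral.integral_congr fun x hx => ?_
          rw [uIcc_of_le S.lt.le] at hx
          simp only [hz x hx hx.1]
      _ = E S.q := by rw [intervalIntegral.integral_mul_const, S.mass, one_mul]
  have h4 := mul_nonneg (h0 _ S.right_mem) (neg_nonneg.2 h)
  simp only [ray, h1, hz S.p S.left_mem le_rfl]
  linarith

lemma exists_threshold (hD : 0 ≤ D) (h : S.a - S.b - D ≤ 0) :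
    ∃ l ∈ Icc S.p S.q, S.Upper D l ∧ S.Lower D l := by
  set w : ℝ → ℝ := fun l => S.a - D * ∫ x in l..S.q, S.f x with hw
  have hwc : Continuous w := by
    have : Continuous fun l => ∫ x in S.q..l, S.f x :=
      intervalIntegral.continuous_primitive (fun u v => S.cont.intervalIntegrable u v) _
    have h' : w = fun l => S.a + D * ∫ x in S.q..l, S.f x := by
      funext l
      rw [hw]
      simp only [intervalIntegral.integral_symm S.q l]
      ring
    rw [h']
    fun_prop
  have hq : 0 ≤ w S.q := by simp [hw, S.a_nonneg]
  rcases le_total 0 (w S.p) with hp | hp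
  · exact ⟨S.p, S.left_mem, S.upper_of_nonneg hD S.left_mem hp, S.lower_left h⟩
  · obtain ⟨l, hl, h0⟩ := intermediate_value_Icc S.lt.le hwc.continuousOn ⟨hp, hq⟩
    exact ⟨l, hl, S.upper_of_nonneg hD hl h0.ge, S.lower_of_nonpos hD hl h0.le⟩

lemma max_sub_max_mono {k k' x x' s s' : ℝ} (hs : s ≤ s') (hx : x - k ≤ x' - k') :
    max k (s' + x) - max k (s + x) ≤ max k' (s' + x') - max k' (s + x') := by
  simp only [max_def]
  split_ifs <;> linarith

/-- Along a ray, the virtual value of `max k (s + x)` increases in `s` up to `-l`. -/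
lemma ray_max_le_of_le {l s s' : ℝ} (hU : S.Upper D l) {k : ℝ → ℝ} (hk : Continuous k)
    (hkm : MonotoneOn (fun x => x - k x) (Icc S.p S.q)) (hk0 : ∀ x, 0 ≤ k x)
    (hs : s ≤ s') (hs' : s' ≤ -l) :
    S.ray D (fun x => max (k x) (s + x)) ≤ S.ray D (fun x => max (k x) (s' + x)) := by
  rw [← sub_nonneg, ← S.ray_sub (by fun_prop) (by fun_prop)]
  refine hU _ (by fun_prop) (fun x hx x' hx' hxx => max_sub_max_mono hs (hkm hx hx' hxx))
    (fun x _ => sub_nonneg.2 (max_le_max le_rfl (by linarith))) fun x _ hxl => ?_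
  rw [max_eq_left (by linarith [hk0 x]), max_eq_left (by linarith [hk0 x]), sub_self]

/-- Along a ray, the virtual value of `max k (s + x)` decreases in `s` from `-l` on. -/
lemma ray_max_le_of_ge {l s s' : ℝ} (hL : S.Lower D l) {k : ℝ → ℝ} (hk : Continuous k)
    (hkm : MonotoneOn (fun x => x - k x) (Icc S.p S.q))
    (hkl : ∀ x ∈ Icc S.p S.q, l ≤ x → k x ≤ s + x) (hs : s ≤ s') :
    S.ray D (fun x => max (k x) (s' + x)) ≤ S.ray D (fun x => max (k x) (s + x)) := by
  rw [← sub_nonpos, ← S.ray_sub (by fun_prop) (by fun_prop)]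
  have key : ∀ x ∈ Icc S.p S.q, l ≤ x → max (k x) (s' + x) - max (k x) (s + x) = s' - s := by
    intro x hx hlx
    have := hkl x hx hlx
    rw [max_eq_right (by linarith), max_eq_right this]
    ring
  refine hL _ (by fun_prop) (fun x hx x' hx' hxx => max_sub_max_mono hs (hkm hx hx' hxx))
    (fun x _ => sub_nonneg.2 (max_le_max le_rfl (by linarith))) fun x hx hxl => ?_
  rw [key x hx hxl, key S.q S.right_mem (hxl.trans hx.2)]

end Side

/-- The virtual value of a utility function `u` on a product of two sides. -/
def virtualValue (S T : Side) (D : ℝ) (u : ℝ × ℝ → ℝ) : ℝ :=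
  (∫ y in T.p..T.q, T.f y * S.ray D (fun x => u (x, y))) +
    ∫ x in S.p..S.q, S.f x * (T.a * u (x, T.q) - T.b * u (x, T.p))

lemma continuous_ray_slice (S : Side) (D : ℝ) {u : ℝ × ℝ → ℝ} (hu : Continuous u) :
    Continuous fun y => S.ray D (fun x => u (x, y)) := by
  have h : Continuous fun y => ∫ x in S.p..S.q, S.f x * u (x, y) := by
    apply intervalIntegral.continuous_parametric_intervalIntegral_of_continuous'
    have := S.cont
    fun_prop
  simp only [Side.ray]
  fun_prop

lemma virtualValue_le {S T : Side} {D : ℝ} {u v : ℝ × ℝ → ℝ} (hu : Continuous u)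
    (hv : Continuous v)
    (hray : ∀ y ∈ Icc T.p T.q, S.ray D (fun x => u (x, y)) ≤ S.ray D (fun x => v (x, y)))
    (htop : ∀ x ∈ Icc S.p S.q, u (x, T.q) ≤ v (x, T.q))
    (hbot : ∀ x ∈ Icc S.p S.q, v (x, T.p) ≤ u (x, T.p)) :
    virtualValue S T D u ≤ virtualValue S T D v := by
  have hS := S.cont
  have hT := T.cont
  refine add_le_add ?_ ?_
  · refine intervalIntegral.integral_mono_on T.lt.le
      ((hT.mul (continuous_ray_slice S D hu)).intervalIntegrable _ _)
      ((hT.mul (continuous_ray_slice S D hv)).intervalIntegrable _ _) fun y hy =>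
      mul_le_mul_of_nonneg_left (hray y hy) (T.nonneg y)
  · refine intervalIntegral.integral_mono_on S.lt.le
      (Continuous.intervalIntegrable (by fun_prop) _ _)
      (Continuous.intervalIntegrable (by fun_prop) _ _) fun x hx =>
      mul_le_mul_of_nonneg_left ?_ (S.nonneg x)
    linarith [mul_le_mul_of_nonneg_left (htop x hx) T.a_nonneg,
      mul_le_mul_of_nonneg_left (hbot x hx) T.b_nonneg]

lemma virtualValue_congr {S T : Side} {D : ℝ} {u v : ℝ × ℝ → ℝ}
    (h : ∀ x ∈ Icc S.p S.q, ∀ y ∈ Icc T.p T.q, u (x, y) = v (x, y)) :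
    virtualValue S T D u = virtualValue S T D v := by
  have hray : ∀ y ∈ Icc T.p T.q, S.ray D (fun x => u (x, y)) = S.ray D (fun x => v (x, y)) := by
    intro y hy
    simp only [Side.ray, h _ S.left_mem y hy, h _ S.right_mem y hy]
    congr 2
    refine intervalIntegral.integral_congr fun x hx => ?_
    rw [uIcc_of_le S.lt.le] at hx
    simp only [h x hx y hy]
  unfold virtualValue
  congr 1
  · refine intervalIntegral.integral_congr fun y hy => ?_
    rw [uIcc_of_le T.lt.le] at hy
    simp only [hray y hy]
  · refine intervalIntegral.integral_congr fun x hx => ?_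
    rw [uIcc_of_le S.lt.le] at hx
    simp only [h x hx _ T.left_mem, h x hx _ T.right_mem]

lemma virtualValue_eq (S T : Side) (D : ℝ) {u : ℝ × ℝ → ℝ} (hu : Continuous u) :
    virtualValue S T D u = (∫ y in T.p..T.q, T.f y * (S.a * u (S.q, y) - S.b * u (S.p, y))) +
      (∫ x in S.p..S.q, S.f x * (T.a * u (x, T.q) - T.b * u (x, T.p))) -
      D * ∫ y in T.p..T.q, ∫ x in S.p..S.q, S.f x * T.f y * u (x, y) := by
  have hS := S.cont
  have hT := T.cont
  have hc : Continuous fun y => ∫ x in S.p..S.q, S.f x * T.f y * u (x, y) := by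
    apply intervalIntegral.continuous_parametric_intervalIntegral_of_continuous'
    fun_prop
  have h : ∫ y in T.p..T.q, T.f y * S.ray D (fun x => u (x, y)) =
      (∫ y in T.p..T.q, T.f y * (S.a * u (S.q, y) - S.b * u (S.p, y))) -
      D * ∫ y in T.p..T.q, ∫ x in S.p..S.q, S.f x * T.f y * u (x, y) := by
    rw [← intervalIntegral.integral_const_mul, ← intervalIntegral.integral_sub
      (Continuous.intervalIntegrable (by fun_prop) _ _)
      (Continuous.intervalIntegrable (by fun_prop) _ _)]
    refine intervalIntegral.integral_congr fun y _ => ?_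
    have h' : ∫ x in S.p..S.q, S.f x * T.f y * u (x, y)
        = T.f y * ∫ x in S.p..S.q, S.f x * u (x, y) := by
      rw [← intervalIntegral.integral_const_mul]
      congr 1
      funext x
      ring
    simp only [Side.ray, h']
    ring
  rw [virtualValue, h]
  ring

lemma virtualValue_swap (S T : Side) (D : ℝ) {u : ℝ × ℝ → ℝ} (hu : Continuous u) :
    virtualValue T S D (u ∘ Prod.swap) = virtualValue S T D u := by
  have hS := S.cont
  have hT := T.cont
  have hc : Continuous (fun x y => S.f x * T.f y * u (x, y)).uncurry := by fun_prop
  rw [virtualValue_eq S T D hu, virtualValue_eq T S D (hu.comp continuous_swap),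
    ← intervalIntegral_intervalIntegral_swap
      ((hc.continuousOn.integrableOn_compact (isCompact_uIcc.prod isCompact_uIcc)).mono_set
        (prod_mono uIoc_subset_uIcc uIoc_subset_uIcc))]
  simp only [Function.comp, Prod.swap_prod_mk, mul_comm (T.f _) (S.f _)]
  ring

lemma virtualValue_const_sub (S T : Side) (D c : ℝ) {u : ℝ × ℝ → ℝ} (hu : Continuous u) :
    virtualValue S T D (fun z => u z - c)
      = virtualValue S T D u - (S.a - S.b + T.a - T.b - D) * c := by
  have hS := S.cont
  have hT := T.cont
  have hray : ∀ y, S.ray D (fun x => u (x, y) - c)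
      = S.ray D (fun x => u (x, y)) - (S.a - S.b - D) * c := by
    intro y
    rw [S.ray_sub continuous_const (by fun_prop)]
    simp only [Side.ray, intervalIntegral.integral_mul_const, S.mass]
    ring
  have h1 : ∫ y in T.p..T.q, T.f y * S.ray D (fun x => u (x, y) - c)
      = (∫ y in T.p..T.q, T.f y * S.ray D (fun x => u (x, y))) - (S.a - S.b - D) * c := by
    have hr := continuous_ray_slice S D hu
    simp only [hray, mul_sub]
    rw [intervalIntegral.integral_sub (Continuous.intervalIntegrable (by fun_prop) _ _)
      (Continuous.intervalIntegrable (by fun_prop) _ _), intervalIntegral.integral_mul_const, T.mass,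
      one_mul]
  have h2 : ∫ x in S.p..S.q, S.f x * (T.a * (u (x, T.q) - c) - T.b * (u (x, T.p) - c))
      = (∫ x in S.p..S.q, S.f x * (T.a * u (x, T.q) - T.b * u (x, T.p))) - (T.a - T.b) * c := by
    have : ∀ x, S.f x * (T.a * (u (x, T.q) - c) - T.b * (u (x, T.p) - c))
        = S.f x * (T.a * u (x, T.q) - T.b * u (x, T.p)) - S.f x * ((T.a - T.b) * c) := by
      intro x; ring
    simp only [this]
    rw [intervalIntegral.integral_sub (Continuous.intervalIntegrable (by fun_prop) _ _)
      (Continuous.intervalIntegrable (by fun_prop) _ _), intervalIntegral.integral_mul_const, S.mass,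
      one_mul]
  simp only [virtualValue, h1, h2]
  ring

/-- The trace of a utility function on an edge: continuous, convex, with slopes in `[0, 1]`. -/
structure Profile (p q : ℝ) (G : ℝ → ℝ) : Prop where
  cont : Continuous G
  convex : ConvexOn ℝ (Icc p q) G
  mono : MonotoneOn G (Icc p q)
  sub_mono : MonotoneOn (fun x => x - G x) (Icc p q)

/-- The utility function generated by the profiles `G` and `H`. -/
def util (G H : ℝ → ℝ) (z : ℝ × ℝ) : ℝ := max (max 0 (G z.1 + z.2)) (H z.2 + z.1)

/-- The utility function of the menu `(0,0,0)`, `(1,α,s)`, `(β,1,s')`, `(1,1,t)`. -/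
def menu (α β s s' t : ℝ) (z : ℝ × ℝ) : ℝ :=
  max (max 0 (z.1 + α * z.2 - s)) (max (β * z.1 + z.2 - s') (z.1 + z.2 - t))

/-- Some menu of the required form has at least the virtual value of `u`. -/
def Dominated (S T : Side) (D : ℝ) (u : ℝ × ℝ → ℝ) : Prop :=
  ∃ α ∈ Icc (0 : ℝ) 1, ∃ β ∈ Icc (0 : ℝ) 1, ∃ s s' t : ℝ,
    virtualValue S T D u ≤ virtualValue S T D (menu α β s s' t)

lemma continuous_util {G H : ℝ → ℝ} (hG : Continuous G) (hH : Continuous H) :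
    Continuous (util G H) := by
  unfold util
  fun_prop

lemma continuous_menu (α β s s' t : ℝ) : Continuous (menu α β s s' t) := by
  unfold menu
  fun_prop

lemma util_swap (G H : ℝ → ℝ) : util G H ∘ Prod.swap = util H G := by
  funext z
  simp only [util, Function.comp, Prod.fst_swap, Prod.snd_swap]
  exact max_right_comm _ _ _

lemma menu_swap (α β s s' t : ℝ) : menu α β s s' t ∘ Prod.swap = menu β α s' s t := by
  funext z
  simp only [menu, Function.comp, Prod.fst_swap, Prod.snd_swap]
  rw [max_max_max_comm, add_comm z.2 z.1, add_comm z.2 (α * z.1), add_comm (β * z.2) z.1]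

lemma virtualValue_util_swap (S T : Side) (D : ℝ) {G H : ℝ → ℝ} (hG : Continuous G)
    (hH : Continuous H) : virtualValue T S D (util H G) = virtualValue S T D (util G H) := by
  rw [← util_swap, virtualValue_swap S T D (continuous_util hG hH)]

lemma Dominated.of_swap {S T : Side} {D : ℝ} {G H : ℝ → ℝ} (hG : Continuous G)
    (hH : Continuous H) (h : Dominated T S D (util H G)) : Dominated S T D (util G H) := by
  obtain ⟨α, hα, β, hβ, s, s', t, h⟩ := h
  refine ⟨β, hβ, α, hα, s', s, t, ?_⟩
  rwa [← menu_swap, virtualValue_swap T S D (continuous_menu _ _ _ _ _),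
    ← virtualValue_util_swap S T D hG hH]

lemma Dominated.of_le {S T : Side} {D : ℝ} {u v : ℝ × ℝ → ℝ} (h : Dominated S T D v)
    (huv : virtualValue S T D u ≤ virtualValue S T D v) : Dominated S T D u := by
  obtain ⟨α, hα, β, hβ, s, s', t, h⟩ := h
  exact ⟨α, hα, β, hβ, s, s', t, huv.trans h⟩

lemma Profile.max_sub {p q : ℝ} {G : ℝ → ℝ} (hG : Profile p q G) (t : ℝ) :
    Profile p q (fun x => max (G x) (x - t)) where
  cont := hG.cont.max (by fun_prop)
  convex := hG.convex.sup ((convexOn_id (convex_Icc p q)).add_const (-t))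
  mono x hx y hy h := max_le_max (hG.mono hx hy h) (by linarith)
  sub_mono x hx y hy h := by
    have h1 := hG.sub_mono hx hy h
    simp only at h1 ⊢
    rcases max_cases (G x) (x - t) with h2 | h2 <;> rcases max_cases (G y) (y - t) with h3 | h3 <;>
      linarith

lemma Profile.chord {p q e : ℝ} {H : ℝ → ℝ} (hH : Profile p q H) (he : e ∈ Icc p q)
    (hpe : p < e) :
    ∃ α ∈ Icc (0 : ℝ) 1, ∃ c, α * p - c = H p ∧ α * e - c = H e ∧
      (∀ y ∈ Icc p e, H y ≤ α * y - c) ∧ ∀ y ∈ Icc e q, α * y - c ≤ H y := by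
  have hp : p ∈ Icc p q := ⟨le_rfl, he.1.trans he.2⟩
  have hpos : 0 < e - p := sub_pos.2 hpe
  set α := (H e - H p) / (e - p) with hα
  have hmul : α * (e - p) = H e - H p := div_mul_cancel₀ _ hpos.ne'
  have h1 := hH.mono hp he he.1
  have h2 := hH.sub_mono hp he he.1
  simp only at h2
  refine ⟨α, ⟨div_nonneg (by linarith) hpos.le, (div_le_one hpos).2 (by linarith)⟩,
    α * p - H p, by ring, by linarith, fun y hy => ?_, fun y hy => ?_⟩
  · rcases eq_or_lt_of_le hy.1 with h | h
    · subst h; linarith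
    rcases eq_or_lt_of_le hy.2 with h' | h'
    · subst h'; linarith
    have h3 := hH.convex.secant_mono_aux1 hp he h h'
    have h4 : (e - p) * H y ≤ (e - p) * (α * y - (α * p - H p)) := by
      have : (e - p) * (α * y - (α * p - H p)) = α * (e - p) * (y - p) + (e - p) * H p := by ring
      rw [this, hmul]
      linarith
    exact le_of_mul_le_mul_left h4 hpos
  · rcases eq_or_lt_of_le hy.1 with h | h
    · subst h; linarith
    have h3 := hH.convex.secant_mono_aux1 hp ⟨hp.1.trans (he.1.trans hy.1), hy.2⟩ hpe h
    have h4 : (e - p) * (α * y - (α * p - H p)) ≤ (e - p) * H y := by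
      have : (e - p) * (α * y - (α * p - H p)) = α * (e - p) * (y - p) + (e - p) * H p := by ring
      rw [this, hmul]
      linarith
    exact le_of_mul_le_mul_left h4 hpos

/-- A profile can be compared with a line that moves its values towards a prescribed level `σ`. -/
lemma Profile.exists_line {p q m : ℝ} {H : ℝ → ℝ} (hH : Profile p q H) (hm : m ∈ Icc p q)
    (σ : ℝ) :
    ∃ α ∈ Icc (0 : ℝ) 1, ∃ c, α * p - c = H p ∧ ∃ e ∈ Icc p m,
      (∀ y ∈ Icc p e, H y ≤ α * y - c ∧ (α * y - c ≤ σ ∨ α * y - c = H y)) ∧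
      ∀ y ∈ Icc e q, α * y - c ≤ H y ∧ (m ≤ y ∨ σ ≤ α * y - c) := by
  have hp : p ∈ Icc p q := ⟨le_rfl, hm.1.trans hm.2⟩
  by_cases hdeg : σ ≤ H p ∨ p = m
  · refine ⟨0, by simp, -H p, by ring, p, ⟨le_rfl, hm.1⟩, fun y hy => ?_, fun y hy => ?_⟩
    · obtain rfl : y = p := le_antisymm hy.2 hy.1
      simp
    · have := hH.mono hp hy hy.1
      simp only [zero_mul, zero_sub, neg_neg]
      refine ⟨this, ?_⟩
      rcases hdeg with h | h
      · exact Or.inr h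
      · exact Or.inl (h ▸ hy.1)
  push Not at hdeg
  obtain ⟨hσ, hpm⟩ := hdeg
  obtain ⟨e, he, hpe, hee⟩ : ∃ e ∈ Icc p m, p < e ∧ H e ≤ σ ∧ (e = m ∨ H e = σ) := by
    rcases le_total (H m) σ with h | h
    · exact ⟨m, ⟨hm.1, le_rfl⟩, lt_of_le_of_ne hm.1 hpm, h, Or.inl rfl⟩
    · obtain ⟨e, he, h'⟩ := intermediate_value_Icc hm.1 hH.cont.continuousOn ⟨hσ.le, h⟩
      refine ⟨e, he, lt_of_le_of_ne he.1 ?_, h'.le, Or.inr h'⟩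
      rintro rfl
      exact hσ.ne h'
  obtain ⟨α, hα, c, h1, h2, h3, h4⟩ := hH.chord ⟨he.1, he.2.trans hm.2⟩ hpe
  refine ⟨α, hα, c, h1, e, he, fun y hy => ⟨h3 y hy, Or.inl ?_⟩, fun y hy => ⟨h4 y hy, ?_⟩⟩
  · have := mul_le_mul_of_nonneg_left hy.2 hα.1
    linarith [hee.1]
  · rcases hee.2 with h | h
    · exact Or.inl (h ▸ hy.1)
    · have := mul_le_mul_of_nonneg_left hy.1 hα.1
      exact Or.inr (by linarith)

/-- Replacing a profile by a two-piece one without lowering the virtual value. -/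
lemma exists_two_piece {S T : Side} {D l t m : ℝ} (hU : S.Upper D l) (hL : S.Lower D l)
    {G H : ℝ → ℝ} (hG : Continuous G) (hGm : MonotoneOn (fun x => x - G x) (Icc S.p S.q))
    (hGt : ∀ x ∈ Icc S.p S.q, l ≤ x → G x ≤ x - t) (hH : Profile T.p T.q H)
    (hHt : ∀ y ∈ Icc T.p T.q, y - t ≤ H y) (hm : m ∈ Icc T.p T.q)
    (hHm : ∀ y ∈ Icc T.p T.q, m ≤ y → H y = y - t) :
    ∃ α ∈ Icc (0 : ℝ) 1, ∃ c, (∀ y ∈ Icc T.p T.q, m ≤ y → α * y - c ≤ y - t) ∧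
      virtualValue S T D (util G H) ≤
        virtualValue S T D (util G (fun y => max (α * y - c) (y - t))) := by
  obtain ⟨α, hα, c, hp, e, he, h1, h2⟩ := hH.exists_line hm (-l)
  have hline : ∀ y ∈ Icc T.p T.q, m ≤ y → α * y - c ≤ y - t := fun y hy hmy =>
    (h2 y ⟨he.2.trans hmy, hy.2⟩).1.trans (hHm y hy hmy).le
  refine ⟨α, hα, c, hline, virtualValue_le (continuous_util hG hH.cont)
    (continuous_util hG (by fun_prop)) (fun y hy => ?_) (fun x _ => ?_) fun x _ => ?_⟩
  · have hk : Continuous fun x => max 0 (G x + y) := by fun_prop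
    have hkm : MonotoneOn (fun x => x - max 0 (G x + y)) (Icc S.p S.q) := by
      intro x hx x' hx' h
      have := hGm hx hx' h
      simp only at this ⊢
      rcases max_cases 0 (G x + y) with h3 | h3 <;> rcases max_cases 0 (G x' + y) with h4 | h4 <;>
        linarith
    have hcase : max (α * y - c) (y - t) = H y ∨
        (H y ≤ max (α * y - c) (y - t) ∧ max (α * y - c) (y - t) ≤ -l) ∨
        (-l ≤ max (α * y - c) (y - t) ∧ max (α * y - c) (y - t) ≤ H y) := by
      rcases le_total y e with hye | hye
      · obtain ⟨h3, h4⟩ := h1 y ⟨hy.1, hye⟩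
        rw [max_eq_left ((hHt y hy).trans h3)]
        rcases h4 with h4 | h4
        · exact Or.inr (Or.inl ⟨h3, h4⟩)
        · exact Or.inl h4
      · obtain ⟨h3, h4⟩ := h2 y ⟨hye, hy.2⟩
        rcases h4 with h4 | h4
        · left
          rw [max_eq_right (hline y hy h4), hHm y hy h4]
        · exact Or.inr (Or.inr ⟨h4.trans (le_max_left _ _), max_le h3 (hHt y hy)⟩)
    simp only [util]
    rcases hcase with h | ⟨h, h'⟩ | ⟨h, h'⟩
    · rw [h]
    · exact S.ray_max_le_of_le hU hk hkm (fun x => le_max_left _ _) h h'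
    · refine S.ray_max_le_of_ge hL hk hkm (fun x hx hlx => max_le (by linarith) ?_) h'
      have := hGt x hx hlx
      have := le_max_right (α * y - c) (y - t)
      linarith
  · have := hHm T.q T.right_mem hm.2
    simp only [util, this, max_eq_right (hline T.q T.right_mem hm.2), le_refl]
  · have := hHt T.p T.left_mem
    simp only [util, hp, max_eq_left this, le_refl]

lemma Dominated.of_two_piece {S T : Side} {D α β c d t : ℝ} (hα : α ∈ Icc (0 : ℝ) 1)
    (hβ : β ∈ Icc (0 : ℝ) 1) :
    Dominated S T D
      (util (fun x => max (β * x - d) (x - t)) (fun y => max (α * y - c) (y - t))) := by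
  refine ⟨α, hα, β, hβ, c, d, t, (congrArg _ ?_).le⟩
  funext z
  simp only [util, menu]
  have e1 : max (β * z.1 - d) (z.1 - t) + z.2 = max (β * z.1 + z.2 - d) (z.1 + z.2 - t) := by
    rw [max_add]; congr 1 <;> ring
  have e2 : max (α * z.2 - c) (z.2 - t) + z.1 = max (z.1 + α * z.2 - c) (z.1 + z.2 - t) := by
    rw [max_add]; congr 1 <;> ring
  rw [e1, e2]
  generalize z.1 + α * z.2 - c = A
  generalize β * z.1 + z.2 - d = B
  generalize z.1 + z.2 - t = C
  rw [max_max_max_comm, max_right_comm, ← max_assoc, max_right_comm, max_assoc]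
  simp only [max_def]
  split_ifs <;> linarith

lemma dominated_of_both {S T : Side} {D l m t : ℝ} (hU : S.Upper D l) (hL : S.Lower D l)
    (hl : l ∈ Icc S.p S.q) (hU' : T.Upper D m) (hL' : T.Lower D m) (hm : m ∈ Icc T.p T.q)
    {G H : ℝ → ℝ} (hG : Profile S.p S.q G) (hH : Profile T.p T.q H)
    (hGt : ∀ x ∈ Icc S.p S.q, x - t ≤ G x) (hGl : ∀ x ∈ Icc S.p S.q, l ≤ x → G x = x - t)
    (hHt : ∀ y ∈ Icc T.p T.q, y - t ≤ H y) (hHm : ∀ y ∈ Icc T.p T.q, m ≤ y → H y = y - t) :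
    Dominated S T D (util G H) := by
  obtain ⟨α, hα, c, h1, h2⟩ := exists_two_piece hU hL hG.cont hG.sub_mono
    (fun x hx h => (hGl x hx h).le) hH hHt hm hHm
  refine Dominated.of_le ?_ h2
  have hc : Continuous fun y => max (α * y - c) (y - t) := by fun_prop
  refine Dominated.of_swap hG.cont hc ?_
  have hcm : MonotoneOn (fun y => y - max (α * y - c) (y - t)) (Icc T.p T.q) := by
    intro y _ y' _ h
    have := mul_le_mul_of_nonneg_right hα.2 (sub_nonneg.2 h)
    simp only
    rcases max_cases (α * y - c) (y - t) with h3 | h3 <;>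
      rcases max_cases (α * y' - c) (y' - t) with h4 | h4 <;> linarith
  obtain ⟨β, hβ, d, -, h3⟩ := exists_two_piece hU' hL' hc hcm
    (fun y hy h => max_le (h1 y hy h) le_rfl) hG hGt hl hGl
  exact Dominated.of_le (Dominated.of_two_piece hβ hα) h3

lemma dominated_of_linear {S T : Side} {D l t : ℝ} (hU : S.Upper D l) (hL : S.Lower D l)
    {G H : ℝ → ℝ} (hG : Continuous G) (hGt : ∀ x ∈ Icc S.p S.q, G x = x - t)
    (hH : Profile T.p T.q H) (hHt : ∀ y ∈ Icc T.p T.q, y - t ≤ H y) (hHq : H T.q = T.q - t) :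
    Dominated S T D (util G H) := by
  obtain ⟨α, hα, c, -, h2⟩ := exists_two_piece (m := T.q) hU hL hG
    (fun x hx x' hx' _ => by simp only [hGt x hx, hGt x' hx']; simp)
    (fun x hx _ => (hGt x hx).le) hH hHt T.right_mem
    fun y hy h => (le_antisymm hy.2 h) ▸ hHq
  refine Dominated.of_le ?_ h2
  refine Dominated.of_le (Dominated.of_two_piece (c := c) (d := t) (t := t) hα
    (right_mem_Icc.2 zero_le_one)) (le_of_eq (virtualValue_congr fun x hx y _ => ?_))
  simp [util, hGt x hx]

/-- Adding the bundle at price `t` to the menu does not lower the virtual value. -/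
lemma virtualValue_util_le_max {S T : Side} {D l t : ℝ} (hU : S.Upper D l) {G H : ℝ → ℝ}
    (hG : Profile S.p S.q G) (hH : Profile T.p T.q H)
    (hGl : ∀ x ∈ Icc S.p S.q, x ≤ l → x - G x ≤ t) (hHp : T.p - H T.p ≤ t) :
    virtualValue S T D (util G H) ≤
      virtualValue S T D (util (fun x => max (G x) (x - t)) (fun y => max (H y) (y - t))) := by
  have hGc := hG.cont
  have hHc := hH.cont
  refine virtualValue_le (continuous_util hGc hHc) (continuous_util (by fun_prop) (by fun_prop))
    (fun y _ => ?_) (fun x _ => ?_) fun x _ => ?_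
  · have key : ∀ x, util (fun x => max (G x) (x - t)) (fun y => max (H y) (y - t)) (x, y)
        = max (util G H (x, y)) (x + y - t) := by
      intro x
      simp only [util]
      have e1 : max (G x) (x - t) + y = max (G x + y) (x + y - t) := by
        rw [max_add]; congr 1; ring
      have e2 : max (H y) (y - t) + x = max (H y + x) (x + y - t) := by
        rw [max_add]; congr 1; ring
      rw [e1, e2, ← max_assoc 0]
      exact (sup_sup_distrib_right (max 0 (G x + y)) (H y + x) (x + y - t)).symm
    have hu : Continuous fun x => util G H (x, y) := (continuous_util hGc hHc).comp (by fun_prop)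
    simp only [key]
    rw [← sub_nonneg, ← S.ray_sub hu (by fun_prop)]
    refine hU _ (by fun_prop) (fun x hx x' hx' h => ?_)
      (fun x _ => sub_nonneg.2 (le_max_left _ _)) fun x hx hxl => ?_
    · have h1 : util G H (x', y) - util G H (x, y) ≤ x' - x := by
        have := hG.sub_mono hx hx' h
        simp only [util] at this ⊢
        rcases max_cases 0 (G x + y) with h3 | h3 <;>
          rcases max_cases 0 (G x' + y) with h4 | h4 <;>
          rcases max_cases (max 0 (G x + y)) (H y + x) with h5 | h5 <;>
          rcases max_cases (max 0 (G x' + y)) (H y + x') with h6 | h6 <;> linarith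
      rcases max_cases (util G H (x, y)) (x + y - t) with h3 | h3 <;>
        rcases max_cases (util G H (x', y)) (x' + y - t) with h4 | h4 <;> linarith
    · have h1 : G x + y ≤ util G H (x, y) := (le_max_right _ _).trans (le_max_left _ _)
      rw [max_eq_left (by linarith [hGl x hx hxl]), sub_self]
  · exact max_le_max (max_le_max le_rfl (by simp)) (by simp)
  · simp only [util]
    have h1 : max (H T.p) (T.p - t) = H T.p := max_eq_left (by linarith)
    rw [h1]
    refine max_le (max_le ((le_max_left _ _).trans (le_max_left _ _)) ?_) (le_max_right _ _)
    rw [max_add]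
    refine max_le ((le_max_right _ _).trans (le_max_left _ _)) (le_max_of_le_right ?_)
    linarith

lemma dominated_of_upper {S T : Side} {D l m : ℝ} (hU : S.Upper D l) (hU' : T.Upper D m)
    (hL' : T.Lower D m) {G H : ℝ → ℝ} (hG : Profile S.p S.q G) (hH : Profile T.p T.q H)
    (hGH : S.q - G S.q = T.q - H T.q)
    (hGl : ∀ x ∈ Icc S.p S.q, x ≤ l → x - G x ≤ T.p - H T.p) :
    Dominated S T D (util G H) := by
  set t := T.p - H T.p with ht
  have hmono : ∀ y ∈ Icc T.p T.q, t ≤ y - H y := fun y hy => hH.sub_mono T.left_mem hy hy.1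
  refine Dominated.of_le ?_ (virtualValue_util_le_max hU hG hH hGl ht.ge)
  have hG' := hG.max_sub t
  have hH' := hH.max_sub t
  refine Dominated.of_swap hG'.cont hH'.cont (dominated_of_linear hU' hL' hH'.cont
    (fun y hy => max_eq_right (by linarith [hmono y hy])) hG' (fun x _ => le_max_right _ _)
    (max_eq_right ?_))
  linarith [hmono T.q T.right_mem]

lemma dominated_of_le {S T : Side} {D l m : ℝ} (hU : S.Upper D l) (hL : S.Lower D l)
    (hl : l ∈ Icc S.p S.q) (hU' : T.Upper D m) (hL' : T.Lower D m) (hm : m ∈ Icc T.p T.q)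
    {G H : ℝ → ℝ} (hG : Profile S.p S.q G) (hH : Profile T.p T.q H)
    (hGH : S.q - G S.q = T.q - H T.q) (hlm : l - G l ≤ m - H m) :
    Dominated S T D (util G H) := by
  have hGl : ∀ x ∈ Icc S.p S.q, x ≤ l → x - G x ≤ l - G l := fun x hx h => hG.sub_mono hx hl h
  rcases le_total (T.p - H T.p) (l - G l) with h | h
  · refine Dominated.of_le ?_ (virtualValue_util_le_max hU hG hH hGl h)
    refine dominated_of_both hU hL hl hU' hL' hm (hG.max_sub _) (hH.max_sub _)
      (fun x _ => le_max_right _ _) (fun x hx hlx => max_eq_right ?_)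
      (fun x _ => le_max_right _ _) (fun y hy hmy => max_eq_right ?_)
    · have := hG.sub_mono hl hx hlx
      simp only at this
      linarith
    · have := hH.sub_mono hm hy hmy
      simp only at this
      linarith
  · exact dominated_of_upper hU hU' hL' hG hH hGH fun x hx hxl => (hGl x hx hxl).trans h

lemma dominated_util {S T : Side} {D : ℝ} (hD : 0 ≤ D)
    (hmass : S.a - S.b + (T.a - T.b) - D ≤ 0) {G H : ℝ → ℝ} (hG : Profile S.p S.q G)
    (hH : Profile T.p T.q H) (hGH : S.q - G S.q = T.q - H T.q) :
    Dominated S T D (util G H) := by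
  by_cases hS : S.a - S.b - D ≤ 0
  · obtain ⟨l, hl, hU, hL⟩ := S.exists_threshold hD hS
    by_cases hT : T.a - T.b - D ≤ 0
    · obtain ⟨m, hm, hU', hL'⟩ := T.exists_threshold hD hT
      rcases le_total (l - G l) (m - H m) with h | h
      · exact dominated_of_le hU hL hl hU' hL' hm hG hH hGH h
      · exact Dominated.of_swap hG.cont hH.cont
          (dominated_of_le hU' hL' hm hU hL hl hH hG hGH.symm h)
    · exact Dominated.of_swap hG.cont hH.cont
        (dominated_of_upper (T.upper_below hD (le_of_not_ge hT)) hU hL hH hG hGH.symm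
          fun x hx h => by linarith [hx.1])
  · obtain ⟨m, hm, hU', hL'⟩ := T.exists_threshold hD (by linarith)
    exact dominated_of_upper (S.upper_below hD (le_of_not_ge hS)) hU' hL' hG hH hGH
      fun x hx h => by linarith [hx.1]

lemma mem_V {xA xB yA yC x y : ℝ} :
    (x, y) ∈ V xA xB yA yC ↔ x ∈ Icc xA xB ∧ y ∈ Icc yA yC := by
  rw [V, ← Icc_prod_Icc, mem_prod]

lemma Feasible.profile_fst {p q p' q' y : ℝ} {u : ℝ × ℝ → ℝ} (h : Feasible p q p' q' u)
    (hu : Continuous u) (hy : y ∈ Icc p' q') (c : ℝ) : Profile p q (fun x => u (x, y) - c) where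
  cont := by fun_prop
  convex := by
    refine ⟨convex_Icc _ _, fun x hx x' hx' a b ha hb hab => ?_⟩
    have := h.2.1.2 (mem_V.2 ⟨hx, hy⟩) (mem_V.2 ⟨hx', hy⟩) ha hb hab
    simp only [Prod.smul_mk, Prod.mk_add_mk, smul_eq_mul, ← add_mul, hab, one_mul] at this ⊢
    linear_combination this + c * hab
  mono x hx x' hx' hxx := by linarith [(h.2.2.1 x x' y hx.1 hxx hx'.2 hy).1]
  sub_mono x hx x' hx' hxx := by
    have := (h.2.2.1 x x' y hx.1 hxx hx'.2 hy).2
    simp only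
    linarith

lemma Feasible.profile_snd {p q p' q' x : ℝ} {u : ℝ × ℝ → ℝ} (h : Feasible p q p' q' u)
    (hu : Continuous u) (hx : x ∈ Icc p q) (c : ℝ) : Profile p' q' (fun y => u (x, y) - c) where
  cont := by fun_prop
  convex := by
    refine ⟨convex_Icc _ _, fun y hy y' hy' a b ha hb hab => ?_⟩
    have := h.2.1.2 (mem_V.2 ⟨hx, hy⟩) (mem_V.2 ⟨hx, hy'⟩) ha hb hab
    simp only [Prod.smul_mk, Prod.mk_add_mk, smul_eq_mul, ← add_mul, hab, one_mul] at this ⊢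
    linear_combination this + c * hab
  mono y hy y' hy' hyy := by linarith [(h.2.2.2 x y y' hx hy.1 hyy hy'.2).1]
  sub_mono y hy y' hy' hyy := by
    have := (h.2.2.2 x y y' hx hy.1 hyy hy'.2).2
    simp only
    linarith

/-- Every continuous feasible utility function is dominated by a menu: its traces on the upper and
right edges generate a utility function of larger virtual value. -/
lemma Feasible.dominated {S T : Side} {D : ℝ} (hD : 0 ≤ D)
    (hmass : S.a - S.b + (T.a - T.b) - D ≤ 0) {u : ℝ × ℝ → ℝ} (hu : Continuous u)
    (h : Feasible S.p S.q T.p T.q u) : Dominated S T D u := by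
  have hG := h.profile_fst hu T.right_mem T.q
  have hH := h.profile_snd hu S.right_mem S.q
  have hx : ∀ x ∈ Icc S.p S.q, ∀ y ∈ Icc T.p T.q, u (S.q, y) - S.q + x ≤ u (x, y) :=
    fun x hx y hy => by linarith [(h.2.2.1 x S.q y hx.1 hx.2 le_rfl hy).2]
  have hy : ∀ x ∈ Icc S.p S.q, ∀ y ∈ Icc T.p T.q, u (x, T.q) - T.q + y ≤ u (x, y) :=
    fun x hx y hy => by linarith [(h.2.2.2 x y T.q hx hy.1 hy.2 le_rfl).2]
  have hle : ∀ x ∈ Icc S.p S.q, ∀ y ∈ Icc T.p T.q,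
      util (fun x => u (x, T.q) - T.q) (fun y => u (S.q, y) - S.q) (x, y) ≤ u (x, y) :=
    fun x hx' y hy' => max_le (max_le (h.1 _ (mem_V.2 ⟨hx', hy'⟩)) (hy x hx' y hy')) (hx x hx' y hy')
  refine Dominated.of_le (dominated_util hD hmass hG hH (by ring)) ?_
  have hc := continuous_util hG.cont hH.cont
  refine virtualValue_le hu hc (fun y hy' => ?_) (fun x _ => ?_) fun x hx' => hle x hx' _ T.left_mem
  · refine S.ray_le_of_eq_right hD (by fun_prop) (by fun_prop) (fun x hx' => hle x hx' y hy')
      (le_antisymm (hle _ S.right_mem y hy') ?_)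
    simp [util]
  · simp [util]

lemma continuous_virtualValue_menu (S T : Side) (D : ℝ) :
    Continuous fun θ : ℝ × ℝ × ℝ × ℝ × ℝ =>
      virtualValue S T D (menu θ.1 θ.2.1 θ.2.2.1 θ.2.2.2.1 θ.2.2.2.2) := by
  have hS := S.cont
  have hT := T.cont
  have h (θ : ℝ × ℝ × ℝ × ℝ × ℝ) :=
    virtualValue_eq S T D (continuous_menu θ.1 θ.2.1 θ.2.2.1 θ.2.2.2.1 θ.2.2.2.2)
  simp only [h, menu]
  have h1 : Continuous fun w : (ℝ × ℝ × ℝ × ℝ × ℝ) × ℝ => ∫ x in S.p..S.q, S.f x * T.f w.2 *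
      max (max 0 (x + w.1.1 * w.2 - w.1.2.2.1)) (max (w.1.2.1 * x + w.2 - w.1.2.2.2.1)
        (x + w.2 - w.1.2.2.2.2)) := by
    apply intervalIntegral.continuous_parametric_intervalIntegral_of_continuous'
    fun_prop
  refine ((?_ : Continuous _).add (?_ : Continuous _)).sub
    (continuous_const.mul (?_ : Continuous _)) <;>
  · apply intervalIntegral.continuous_parametric_intervalIntegral_of_continuous'
    first
      | exact h1
      | fun_prop

lemma menu_mono {α β s s' t : ℝ} (hα : 0 ≤ α) (hβ : 0 ≤ β) {x y x' y' : ℝ} (hx : x ≤ x')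
    (hy : y ≤ y') : menu α β s s' t (x, y) ≤ menu α β s s' t (x', y') :=
  max_le_max (max_le_max le_rfl (by linarith [mul_le_mul_of_nonneg_left hy hα]))
    (max_le_max (by linarith [mul_le_mul_of_nonneg_left hx hβ]) (by linarith))

/-- Shifting a menu so that the lowest type gets utility zero, and capping its prices. -/
lemma menu_sub_eq {α β s s' t p q p' q' : ℝ} (hα : α ∈ Icc (0 : ℝ) 1) (hβ : β ∈ Icc (0 : ℝ) 1)
    (hp : 0 ≤ p) (hp' : 0 ≤ p') {m : ℝ} (hm : m = menu α β s s' t (p, p'))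
    {x y : ℝ} (hx : x ∈ Icc p q) (hy : y ∈ Icc p' q') :
    menu α β s s' t (x, y) - m =
      menu α β (min (s + m) (q + q')) (min (s' + m) (q + q')) (min (t + m) (q + q')) (x, y) := by
  have hmono : m ≤ menu α β s s' t (x, y) := hm ▸ menu_mono hα.1 hβ.1 hx.1 hy.1
  have hm0 : 0 ≤ m := hm ▸ (le_max_left _ _).trans (le_max_left _ _)
  have h1 : α * y ≤ y := mul_le_of_le_one_left (hp'.trans hy.1) hα.2
  have h2 : β * x ≤ x := mul_le_of_le_one_left (hp.trans hx.1) hβ.2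
  have hxq := hx.2
  have hyq := hy.2
  apply le_antisymm
  · rw [sub_le_iff_le_add]
    simp only [menu]
    refine max_le (max_le ?_ ?_) (max_le ?_ ?_)
    · exact add_nonneg ((le_max_left _ _).trans (le_max_left _ _)) hm0
    · rw [← sub_le_iff_le_add]
      refine le_max_of_le_left (le_max_of_le_right ?_)
      linarith [min_le_left (s + m) (q + q')]
    · rw [← sub_le_iff_le_add]
      refine le_max_of_le_right (le_max_of_le_left ?_)
      linarith [min_le_left (s' + m) (q + q')]
    · rw [← sub_le_iff_le_add]
      refine le_max_of_le_right (le_max_of_le_right ?_)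
      linarith [min_le_left (t + m) (q + q')]
  · have hs : x + α * y - s ≤ menu α β s s' t (x, y) := (le_max_right _ _).trans (le_max_left _ _)
    have hs' : β * x + y - s' ≤ menu α β s s' t (x, y) :=
      (le_max_left _ _).trans (le_max_right _ _)
    have ht : x + y - t ≤ menu α β s s' t (x, y) := (le_max_right _ _).trans (le_max_right _ _)
    refine max_le (max_le (sub_nonneg.2 hmono) ?_) (max_le ?_ ?_) <;>
      simp only
    · rcases min_choice (s + m) (q + q') with h | h <;> rw [h] <;> linarith
    · rcases min_choice (s' + m) (q + q') with h | h <;> rw [h] <;> linarith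
    · rcases min_choice (t + m) (q + q') with h | h <;> rw [h] <;> linarith

lemma exists_best_menu {S T : Side} {D : ℝ} (hmass : S.a - S.b + T.a - T.b - D ≤ 0)
    (hp : 0 ≤ S.p) (hp' : 0 ≤ T.p) :
    ∃ α ∈ Icc (0 : ℝ) 1, ∃ β ∈ Icc (0 : ℝ) 1, ∃ s s' t : ℝ, ∀ u : ℝ × ℝ → ℝ, Dominated S T D u →
      virtualValue S T D u ≤ virtualValue S T D (menu α β s s' t) := by
  have hM : 0 ≤ S.q + T.q := by linarith [S.lt, T.lt]
  set J := Icc (0 : ℝ) (S.q + T.q)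
  have hJ : ∀ a, 0 ≤ a → min a (S.q + T.q) ∈ J := fun a ha => ⟨le_min ha hM, min_le_right _ _⟩
  obtain ⟨⟨α, β, s, s', t⟩, hθ, hmax⟩ :=
    IsCompact.exists_isMaxOn (s := Icc (0 : ℝ) 1 ×ˢ Icc (0 : ℝ) 1 ×ˢ J ×ˢ J ×ˢ J)
      (isCompact_Icc.prod (isCompact_Icc.prod (isCompact_Icc.prod
        (isCompact_Icc.prod isCompact_Icc))))
      ⟨(0, 0, 0, 0, 0), by simp [J, hM]⟩ (continuous_virtualValue_menu S T D).continuousOn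
  refine ⟨α, hθ.1, β, hθ.2.1, s, s', t, fun u ⟨a, ha, b, hb, r, r', c, h⟩ => h.trans ?_⟩
  obtain ⟨m, hm⟩ : ∃ m, m = menu a b r r' c (S.p, T.p) := ⟨_, rfl⟩
  have hm0 : 0 ≤ m := hm ▸ (le_max_left _ _).trans (le_max_left _ _)
  have h1 : virtualValue S T D (menu a b r r' c)
      ≤ virtualValue S T D (fun z => menu a b r r' c z - m) := by
    rw [virtualValue_const_sub S T D m (continuous_menu _ _ _ _ _)]
    linarith [mul_nonpos_of_nonpos_of_nonneg hmass hm0]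
  refine h1.trans ?_
  rw [virtualValue_congr fun x hx y hy => menu_sub_eq ha hb hp hp' hm hx hy]
  have hr : S.p + a * T.p - r ≤ m := hm ▸ (le_max_right _ _).trans (le_max_left _ _)
  have hr' : b * S.p + T.p - r' ≤ m := hm ▸ (le_max_left _ _).trans (le_max_right _ _)
  have hc : S.p + T.p - c ≤ m := hm ▸ (le_max_right _ _).trans (le_max_right _ _)
  exact hmax (a := (a, b, _, _, _)) ⟨ha, hb, hJ _ (by linarith [mul_nonneg ha.1 hp']),
    hJ _ (by linarith [mul_nonneg hb.1 hp]), hJ _ (by linarith)⟩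

lemma feasible_menu {xA xB yA yC α β : ℝ} (hα : α ∈ Icc (0 : ℝ) 1) (hβ : β ∈ Icc (0 : ℝ) 1)
    (s s' t : ℝ) : Feasible xA xB yA yC (menu α β s s' t) := by
  refine ⟨fun z _ => (le_max_left _ _).trans (le_max_left _ _), ?_, fun x x' y _ h _ _ => ?_,
    fun x y y' _ _ h _ => ?_⟩
  · have haff : ∀ a b c : ℝ, ConvexOn ℝ (V xA xB yA yC) fun z => a * z.1 + b * z.2 - c :=
      fun a b c => ⟨convex_Icc _ _, fun z _ w _ k l _ _ hkl => by
        simp only [Prod.fst_add, Prod.snd_add, Prod.smul_fst, Prod.smul_snd, smul_eq_mul]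
        linear_combination c * hkl⟩
    have h := ((convexOn_const 0 (convex_Icc (xA, yA) (xB, yC))).sup (haff 1 α s)).sup
      ((haff β 1 s').sup (haff 1 1 t))
    simp only [one_mul] at h
    exact h
  · have h1 := mul_le_mul_of_nonneg_left h hβ.1
    have h2 : β * (x' - x) ≤ x' - x := mul_le_of_le_one_left (by linarith) hβ.2
    refine ⟨sub_nonneg.2 (menu_mono hα.1 hβ.1 h le_rfl), ?_⟩
    rw [sub_le_iff_le_add']
    refine max_le (max_le ?_ ?_) (max_le ?_ ?_) <;> rw [← sub_le_iff_le_add]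
    · exact le_max_of_le_left (le_max_of_le_left (by linarith))
    · exact le_max_of_le_left (le_max_of_le_right (by simp only; linarith))
    · exact le_max_of_le_right (le_max_of_le_left (by simp only; linarith))
    · exact le_max_of_le_right (le_max_of_le_right (by simp only; linarith))
  · have h1 := mul_le_mul_of_nonneg_left h hα.1
    have h2 : α * (y' - y) ≤ y' - y := mul_le_of_le_one_left (by linarith) hα.2
    refine ⟨sub_nonneg.2 (menu_mono hα.1 hβ.1 le_rfl h), ?_⟩
    rw [sub_le_iff_le_add']
    refine max_le (max_le ?_ ?_) (max_le ?_ ?_) <;> rw [← sub_le_iff_le_add]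
    · exact le_max_of_le_left (le_max_of_le_left (by linarith))
    · exact le_max_of_le_left (le_max_of_le_right (by simp only; linarith))
    · exact le_max_of_le_right (le_max_of_le_left (by simp only; linarith))
    · exact le_max_of_le_right (le_max_of_le_right (by simp only; linarith))

/-- The density `f` satisfies `(x f)' = k f` on its support, and the weights `a`, `b` are the values
of `x f` at the ends. -/
structure Side.PowerLaw (S : Side) (k : ℝ) : Prop where
  left : S.b = S.p * S.f S.p
  right : S.a = S.q * S.f S.q
  deriv : ∀ x ∈ Icc S.p S.q,
    HasDerivWithinAt (fun x => x * S.f x) (k * S.f x) (Icc S.p S.q) x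

lemma Side.PowerLaw.integral_eq {S : Side} {k : ℝ} (h : S.PowerLaw k) {C : NNReal} {w : ℝ → ℝ}
    (hw : LipschitzWith C w) :
    ∫ x in S.p..S.q, (x * _root_.deriv w x + k * w x) * S.f x = S.a * w S.q - S.b * w S.p := by
  have hS := S.cont
  obtain ⟨K, hK⟩ := (isCompact_Icc (a := S.p) (b := S.q)).exists_bound_of_continuousOn
    (f := fun x => k * S.f x) (by fun_prop)
  have hf : AbsolutelyContinuousOnInterval (fun x => x * S.f x) S.p S.q := by
    refine LipschitzOnWith.absolutelyContinuousOnInterval (K := K.toNNReal) ?_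
    rw [uIcc_of_le S.lt.le]
    exact (convex_Icc _ _).lipschitzOnWith_of_nnnorm_hasDerivWithin_le h.deriv
      fun x hx => by rw [← norm_toNNReal]; exact Real.toNNReal_le_toNNReal (hK x hx)
  have := hf.integral_deriv_mul_eq_sub
    (LipschitzOnWith.absolutelyContinuousOnInterval hw.lipschitzOnWith)
  rw [h.left, h.right, ← this]
  refine intervalIntegral.integral_congr_uIoo fun x hx => ?_
  rw [uIoo_of_le S.lt.le] at hx
  have hd := ((h.deriv x (Ioo_subset_Icc_self hx)).hasDerivAt (Icc_mem_nhds hx.1 hx.2)).deriv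
  simp only [hd]
  ring

lemma Side.PowerLaw.sub_eq {S : Side} {k : ℝ} (h : S.PowerLaw k) : S.a - S.b = k := by
  have := h.integral_eq (LipschitzWith.const (1 : ℝ))
  simp only [deriv_const, mul_zero, zero_add, mul_one, intervalIntegral.integral_const_mul,
    S.mass] at this
  exact this.symm

lemma integrableOn_pd2 {S T : Side} {C : NNReal} {w : ℝ × ℝ → ℝ} (hw : LipschitzWith C w) (k : ℝ) :
    IntegrableOn (fun z => (z.2 * pd2 w z + k * w z) * (S.f z.1 * T.f z.2))
      (Icc S.p S.q ×ˢ Icc T.p T.q) := by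
  have hS := S.cont
  have hT := T.cont
  have hc := hw.continuous
  have hK : IsCompact (Icc S.p S.q ×ˢ Icc T.p T.q) := isCompact_Icc.prod isCompact_Icc
  have hpd : IntegrableOn (pd2 w) (Icc S.p S.q ×ˢ Icc T.p T.q) := by
    refine Measure.integrableOn_of_bounded (M := C * ‖((0 : ℝ), (1 : ℝ))‖) hK.measure_lt_top.ne
      (measurable_fderiv_apply_const ℝ w (0, 1)).aestronglyMeasurable (ae_of_all _ fun z => ?_)
    exact (ContinuousLinearMap.le_opNorm _ _).trans
      (mul_le_mul_of_nonneg_right (norm_fderiv_le_of_lipschitz ℝ hw) (norm_nonneg _))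
  have h1 : IntegrableOn (fun z : ℝ × ℝ => z.2 * pd2 w z) (Icc S.p S.q ×ˢ Icc T.p T.q) :=
    hpd.continuousOn_mul (by fun_prop) hK
  have h2 : IntegrableOn (fun z : ℝ × ℝ => k * w z) (Icc S.p S.q ×ˢ Icc T.p T.q) :=
    ContinuousOn.integrableOn_compact hK (by fun_prop)
  exact (h1.add h2).mul_continuousOn (by fun_prop) hK

lemma integral_pd2 {S T : Side} {k : ℝ} (h : T.PowerLaw k) {C : NNReal} {w : ℝ × ℝ → ℝ}
    (hw : LipschitzWith C w) :
    ∫ z in Icc S.p S.q ×ˢ Icc T.p T.q, (z.2 * pd2 w z + k * w z) * (S.f z.1 * T.f z.2) =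
      ∫ x in S.p..S.q, S.f x * (T.a * w (x, T.q) - T.b * w (x, T.p)) := by
  have hdiff : ∀ᵐ x : ℝ, ∀ᵐ y : ℝ, DifferentiableAt ℝ w (x, y) :=
    Measure.ae_ae_of_ae_prod (hw.ae_differentiableAt (μ := volume))
  rw [Measure.volume_eq_prod, setIntegral_prod _ (integrableOn_pd2 hw k),
    intervalIntegral.integral_of_le S.lt.le, ← integral_Icc_eq_integral_Ioc]
  refine integral_congr_ae (ae_restrict_of_ae ?_)
  filter_upwards [hdiff] with x hx
  have hwx : LipschitzWith C fun y => w (x, y) :=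
    mul_one C ▸ hw.comp (LipschitzWith.prodMk_left x)
  rw [← h.integral_eq hwx, ← intervalIntegral.integral_const_mul,
    intervalIntegral.integral_of_le T.lt.le, ← integral_Icc_eq_integral_Ioc]
  refine integral_congr_ae (ae_restrict_of_ae ?_)
  filter_upwards [hx] with y hy
  have hd : HasDerivAt (fun y => w (x, y)) (pd2 w (x, y)) y :=
    hy.hasFDerivAt.comp_hasDerivAt y ((hasDerivAt_const y x).prodMk (hasDerivAt_id y))
  simp only [hd.deriv]
  ring

lemma pd2_comp_swap (w : ℝ × ℝ → ℝ) (z : ℝ × ℝ) : pd2 (w ∘ Prod.swap) z = pd1 w z.swap := by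
  have := (ContinuousLinearEquiv.prodComm ℝ ℝ ℝ).comp_right_fderiv (f := w) (x := z)
  exact congrArg (fun L : ℝ × ℝ →L[ℝ] ℝ => L (0, 1)) this

lemma lipschitzWith_comp_swap {C : NNReal} {w : ℝ × ℝ → ℝ} (hw : LipschitzWith C w) :
    LipschitzWith C (w ∘ Prod.swap) :=
  LipschitzWith.of_dist_le_mul fun z z' => by
    refine (hw.dist_le_mul _ _).trans_eq ?_
    simp only [Prod.dist_eq, Prod.fst_swap, Prod.snd_swap, max_comm]

lemma integrableOn_pd1 {S T : Side} {C : NNReal} {w : ℝ × ℝ → ℝ} (hw : LipschitzWith C w) (k : ℝ) :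
    IntegrableOn (fun z => (z.1 * pd1 w z + k * w z) * (S.f z.1 * T.f z.2))
      (Icc S.p S.q ×ˢ Icc T.p T.q) := by
  have h := integrableOn_pd2 (S := T) (T := S) (lipschitzWith_comp_swap hw) k
  refine (IntegrableOn.swap (μ := volume) (ν := volume) h).congr (ae_of_all _ fun z => ?_)
  simp [pd2_comp_swap, mul_comm]

lemma integral_pd1 {S T : Side} {k : ℝ} (h : S.PowerLaw k) {C : NNReal} {w : ℝ × ℝ → ℝ}
    (hw : LipschitzWith C w) :
    ∫ z in Icc S.p S.q ×ˢ Icc T.p T.q, (z.1 * pd1 w z + k * w z) * (S.f z.1 * T.f z.2) =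
      ∫ y in T.p..T.q, T.f y * (S.a * w (S.q, y) - S.b * w (S.p, y)) := by
  have := integral_pd2 (S := T) h (lipschitzWith_comp_swap hw)
  simp only [Function.comp_apply, Prod.swap_prod_mk] at this
  rw [← this, Measure.volume_eq_prod, ← setIntegral_prod_swap]
  refine integral_congr_ae (ae_of_all _ fun z => ?_)
  simp [pd2_comp_swap, mul_comm]

/-- Integration by parts: the revenue is the virtual value. -/
lemma rev_eq_virtualValue {S T : Side} {k k' : ℝ} (h : S.PowerLaw k) (h' : T.PowerLaw k')
    {C : NNReal} {w : ℝ × ℝ → ℝ} (hw : LipschitzWith C w) :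
    Rev S.p S.q T.p T.q S.f T.f w = virtualValue S T (k + k' + 1) w := by
  have hS := S.cont
  have hT := T.cont
  have hc := hw.continuous
  have h3 : IntegrableOn (fun z : ℝ × ℝ => S.f z.1 * T.f z.2 * w z)
      (Icc S.p S.q ×ˢ Icc T.p T.q) :=
    ContinuousOn.integrableOn_compact (isCompact_Icc.prod isCompact_Icc) (by fun_prop)
  have hJ : ∫ y in T.p..T.q, ∫ x in S.p..S.q, S.f x * T.f y * w (x, y) =
      ∫ z in Icc S.p S.q ×ˢ Icc T.p T.q, S.f z.1 * T.f z.2 * w z := by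
    rw [Measure.volume_eq_prod, ← setIntegral_prod_swap, setIntegral_prod]
    · simp only [intervalIntegral.integral_of_le S.lt.le, intervalIntegral.integral_of_le T.lt.le,
        integral_Icc_eq_integral_Ioc, Prod.swap_prod_mk]
    · exact ContinuousOn.integrableOn_compact (isCompact_Icc.prod isCompact_Icc) (by fun_prop)
  have h12 := (integrableOn_pd1 (S := S) (T := T) hw k).add
    (integrableOn_pd2 (S := S) (T := T) hw k')
  rw [virtualValue_eq S T _ hc, ← integral_pd1 h hw, ← integral_pd2 h' hw, hJ,
    ← integral_const_mul, ← integral_add (integrableOn_pd1 hw k) (integrableOn_pd2 hw k')]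
  refine Eq.trans ?_ (integral_sub h12 (h3.const_mul (k + k' + 1)))
  rw [Rev, V, ← Icc_prod_Icc]
  refine integral_congr_ae (ae_of_all _ fun z => ?_)
  simp only
  ring

lemma rev_congr {p q p' q' : ℝ} {f1 f2 g1 g2 : ℝ → ℝ} {u w : ℝ × ℝ → ℝ}
    (h1 : ∀ x ∈ Icc p q, f1 x = g1 x) (h2 : ∀ y ∈ Icc p' q', f2 y = g2 y)
    (hu : ∀ z ∈ V p q p' q', u z = w z) : Rev p q p' q' f1 f2 u = Rev p q p' q' g1 g2 w := by
  have hfr := (convex_Icc (p, p') (q, q')).addHaar_frontier volume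
  refine setIntegral_congr_ae measurableSet_Icc ?_
  filter_upwards [measure_eq_zero_iff_ae_notMem.1 hfr] with z hz hzV
  have hint : z ∈ interior (V p q p' q') := by
    by_contra hcon
    exact hz ⟨subset_closure hzV, hcon⟩
  have hev : u =ᶠ[nhds z] w := by
    filter_upwards [mem_interior_iff_mem_nhds.1 hint] with z' hz' using hu z' hz'
  have hz2 := mem_V.1 hzV
  rw [pd1, pd2, pd1, pd2, hev.fderiv_eq, hu z hzV, h1 _ hz2.1, h2 _ hz2.2]

lemma Feasible.exists_lipschitz {p q p' q' : ℝ} (hpq : p ≤ q) (hpq' : p' ≤ q') {u : ℝ × ℝ → ℝ}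
    (h : Feasible p q p' q' u) :
    ∃ w : ℝ × ℝ → ℝ, ∃ C, LipschitzWith C w ∧ ∀ z ∈ V p q p' q', u z = w z := by
  have hx : ∀ x ∈ Icc p q, ∀ x' ∈ Icc p q, ∀ y ∈ Icc p' q', |u (x, y) - u (x', y)| ≤ |x - x'| := by
    intro x hx x' hx' y hy
    rcases le_total x x' with hxx | hxx
    · have := h.2.2.1 x x' y hx.1 hxx hx'.2 hy
      rw [abs_sub_comm, abs_sub_comm x, abs_of_nonneg this.1, abs_of_nonneg (by linarith)]
      exact this.2
    · have := h.2.2.1 x' x y hx'.1 hxx hx.2 hy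
      rw [abs_of_nonneg this.1, abs_of_nonneg (by linarith)]
      exact this.2
  have hy : ∀ x ∈ Icc p q, ∀ y ∈ Icc p' q', ∀ y' ∈ Icc p' q',
      |u (x, y) - u (x, y')| ≤ |y - y'| := by
    intro x hx y hy y' hy'
    rcases le_total y y' with hyy | hyy
    · have := h.2.2.2 x y y' hx hy.1 hyy hy'.2
      rw [abs_sub_comm, abs_sub_comm y, abs_of_nonneg this.1, abs_of_nonneg (by linarith)]
      exact this.2
    · have := h.2.2.2 x y' y hx hy'.1 hyy hy.2
      rw [abs_of_nonneg this.1, abs_of_nonneg (by linarith)]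
      exact this.2
  refine ⟨fun z => u (projIcc p q hpq z.1, projIcc p' q' hpq' z.2), 2,
    LipschitzWith.of_dist_le_mul fun z z' => ?_, fun z hz => ?_⟩
  · have h1 := hx _ (projIcc p q hpq z.1).2 _ (projIcc p q hpq z'.1).2 _
      (projIcc p' q' hpq' z.2).2
    have h2 := hy _ (projIcc p q hpq z'.1).2 _ (projIcc p' q' hpq' z.2).2 _
      (projIcc p' q' hpq' z'.2).2
    have h3 := abs_projIcc_sub_projIcc hpq (c := z.1) (d := z'.1)
    have h4 := abs_projIcc_sub_projIcc hpq' (c := z.2) (d := z'.2)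
    have h5 : |z.1 - z'.1| ≤ dist z z' := le_max_left _ _
    have h6 : |z.2 - z'.2| ≤ dist z z' := le_max_right _ _
    rw [Real.dist_eq]
    refine (abs_sub_le _ (u (projIcc p q hpq z'.1, projIcc p' q' hpq' z.2)) _).trans ?_
    rw [NNReal.coe_ofNat]
    linarith
  · obtain ⟨hz1, hz2⟩ := mem_V.1 hz
    simp only [projIcc_of_mem hpq hz1, projIcc_of_mem hpq' hz2]

lemma Feasible.congr {p q p' q' : ℝ} {u w : ℝ × ℝ → ℝ} (h : Feasible p q p' q' u)
    (huw : ∀ z ∈ V p q p' q', u z = w z) : Feasible p q p' q' w := by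
  refine ⟨fun z hz => huw z hz ▸ h.1 z hz, h.2.1.congr huw, fun x x' y hx hxx hx' hy => ?_,
    fun x y y' hx hy hyy hy' => ?_⟩
  · rw [← huw _ (mem_V.2 ⟨⟨hx, hxx.trans hx'⟩, hy⟩), ← huw _ (mem_V.2 ⟨⟨hx.trans hxx, hx'⟩, hy⟩)]
    exact h.2.2.1 x x' y hx hxx hx' hy
  · rw [← huw _ (mem_V.2 ⟨hx, ⟨hy, hyy.trans hy'⟩⟩), ← huw _ (mem_V.2 ⟨hx, ⟨hy.trans hyy, hy'⟩⟩)]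
    exact h.2.2.2 x y y' hx hy hyy hy'

lemma Feasible.exists_virtualValue {S T : Side} {k k' : ℝ} (hS : S.PowerLaw k)
    (hT : T.PowerLaw k') (hk : 0 ≤ k + k' + 1) {f1 f2 : ℝ → ℝ}
    (h1 : ∀ x ∈ Icc S.p S.q, f1 x = S.f x) (h2 : ∀ y ∈ Icc T.p T.q, f2 y = T.f y)
    {u : ℝ × ℝ → ℝ} (h : Feasible S.p S.q T.p T.q u) :
    Rev S.p S.q T.p T.q f1 f2 u = virtualValue S T (k + k' + 1) u ∧
      Dominated S T (k + k' + 1) u := by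
  obtain ⟨w, C, hw, huw⟩ := h.exists_lipschitz S.lt.le T.lt.le
  have hVV : virtualValue S T (k + k' + 1) u = virtualValue S T (k + k' + 1) w :=
    virtualValue_congr fun x hx y hy => huw _ (mem_V.2 ⟨hx, hy⟩)
  refine ⟨by rw [hVV, rev_congr h1 h2 huw, rev_eq_virtualValue hS hT hw],
    Dominated.of_le ((h.congr huw).dominated hk ?_ hw.continuous) hVV.le⟩
  rw [hS.sub_eq, hT.sub_eq]
  linarith

lemma Density.exists_side {p q c : ℝ} {f : ℝ → ℝ} (h : Density p q f) (hp : 0 ≤ p) (hpq : p < q)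
    (hc : ∀ x ∈ Icc p q, PR f x = c) :
    ∃ S : Side, S.p = p ∧ S.q = q ∧ (∀ x ∈ Icc p q, f x = S.f x) ∧ S.PowerLaw (c + 1) := by
  obtain ⟨hpos, -, hdiff, hint⟩ := h
  have hfe : ∀ x ∈ Icc p q, f x = IccExtend hpq.le (fun x : Icc p q => f x) x :=
    fun x hx => (IccExtend_of_mem hpq.le (fun x : Icc p q => f x) hx).symm
  have hcont : ContinuousOn f (Icc p q) := fun x hx => (hdiff x hx).continuousAt.continuousWithinAt
  refine ⟨⟨p, q, q * f q, p * f p, IccExtend hpq.le (fun x : Icc p q => f x), hpq,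
    mul_nonneg (hp.trans hpq.le) (hpos q ⟨hpq.le, le_rfl⟩).le,
    mul_nonneg hp (hpos p ⟨le_rfl, hpq.le⟩).le, hcont.domRestrict.Icc_extend',
    fun x => (hpos _ (projIcc p q hpq.le x).2).le, ?_⟩, rfl, rfl, hfe, ?_⟩
  · rw [← hint]
    refine intervalIntegral.integral_congr fun x hx => ?_
    rw [uIcc_of_le hpq.le] at hx
    exact (hfe x hx).symm
  · refine ⟨?_, ?_, fun x hx => ?_⟩
    · simp only [hfe p ⟨le_rfl, hpq.le⟩]
    · simp only [hfe q ⟨hpq.le, le_rfl⟩]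
    · simp only at hx ⊢
      have h1 : HasDerivAt (fun x => x * f x) ((c + 1) * f x) x := by
        have h2 := (hasDerivAt_id x).mul (hdiff x hx).hasDerivAt
        refine h2.congr_deriv ?_
        have h3 := hc x hx
        rw [PR, div_eq_iff (hpos x hx).ne'] at h3
        simp only [id, h3]
        ring
      rw [← hfe x hx]
      exact h1.hasDerivWithinAt.congr (fun y hy => by rw [hfe y hy]) (by rw [hfe x hx])

/-- under Conditions 2 and 3, the optimal mechanism has at most 4 menu
items `(0,0,0)`, `(1,α,t_α)`, `(β,1,t_β)`, `(1,1,t₁)`. -/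
theorem stmt12 (xA xB yA yC : ℝ) (h0 : 0 ≤ xA) (h1 : xA < xB) (h2 : 0 ≤ yA) (h3 : yA < yC)
    (f1 f2 : ℝ → ℝ) (hf1 : Density xA xB f1) (hf2 : Density yA yC f2)
    (hC2 : ∀ x ∈ Set.Icc xA xB, ∀ y ∈ Set.Icc yA yC, -3 ≤ PR f1 x + PR f2 y)
    (hC3a : ∃ c1 : ℝ, ∀ x ∈ Set.Icc xA xB, PR f1 x = c1)
    (hC3b : ∃ c2 : ℝ, ∀ y ∈ Set.Icc yA yC, PR f2 y = c2) :
    ∃ α ∈ Set.Icc (0:ℝ) 1, ∃ β ∈ Set.Icc (0:ℝ) 1, ∃ tα tβ t1 : ℝ,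
      Optimal xA xB yA yC f1 f2 (fun z =>
        max (max 0 (z.1 + α * z.2 - tα)) (max (β * z.1 + z.2 - tβ) (z.1 + z.2 - t1))) := by
  obtain ⟨c1, hc1⟩ := hC3a
  obtain ⟨c2, hc2⟩ := hC3b
  have hD := hC2 xA ⟨le_rfl, h1.le⟩ yA ⟨le_rfl, h3.le⟩
  rw [hc1 xA ⟨le_rfl, h1.le⟩, hc2 yA ⟨le_rfl, h3.le⟩] at hD
  obtain ⟨S, rfl, rfl, hSf, hS⟩ := hf1.exists_side h0 h1 hc1
  obtain ⟨T, rfl, rfl, hTf, hT⟩ := hf2.exists_side h2 h3 hc2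
  have key : ∀ u, Feasible S.p S.q T.p T.q u → _ := fun u hu =>
    hu.exists_virtualValue hS hT (by linarith) hSf hTf
  obtain ⟨α, hα, β, hβ, s, s', t, hbest⟩ := exists_best_menu (S := S) (T := T)
    (D := c1 + 1 + (c2 + 1) + 1) (by linarith [hS.sub_eq, hT.sub_eq]) h0 h2
  have hfeas : Feasible S.p S.q T.p T.q (menu α β s s' t) := feasible_menu hα hβ s s' t
  refine ⟨α, hα, β, hβ, s, s', t, hfeas, ?_⟩
  refine Eq.symm (IsGreatest.csSup_eq ⟨⟨_, hfeas, rfl⟩, ?_⟩)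
  rintro _ ⟨u, hu, rfl⟩
  change _ ≤ Rev S.p S.q T.p T.q f1 f2 (menu α β s s' t)
  rw [(key u hu).1, (key _ hfeas).1]
  exact hbest u (key u hu).2
end
end

section
/- Assume Conditions 2 and 3. Then bundling 3-approximates the optimal revenue: 3·BRev ≥ sup over feasible utility functions u of R(u). -/
open MeasureTheory Set

noncomputable section

/-- A monotone allocation rule with values in `[0,1]` earns no more than the best posted price. -/
theorem lintegral_sub_le_of_monotone (μ : Measure ℝ) [SFinite μ] {D : ℝ → ℝ} (hD : Monotone D)
    (h0 : ∀ x, 0 ≤ D x) (h1 : ∀ x, D x ≤ 1) (hμ : ∀ᵐ x ∂μ, 0 ≤ x) {R : ENNReal}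
    (hR : ∀ t, 0 ≤ t → ENNReal.ofReal t * μ (Ici t) ≤ R) :
    ∫⁻ x, (∫⁻ t in Ioi 0, ENNReal.ofReal (D x - D t)) ∂μ ≤ R := by
  set v : ℝ → ENNReal := fun q => volume.restrict (Ioi 0) {t | D t < q} with hv
  have hvm : Measurable v :=
    Monotone.measurable fun p q hpq => measure_mono fun t (ht : D t < p) => ht.trans_le hpq
  have hDm : Measurable D := hD.measurable
  have layer : ∀ x t, ENNReal.ofReal (D x - D t) =
      ∫⁻ q in Ioc 0 1, {q | D t < q ∧ q ≤ D x}.indicator 1 q := by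
    intro x t
    have hm : MeasurableSet {q | D t < q ∧ q ≤ D x} := measurableSet_Ioc
    rw [lintegral_indicator_one hm, Measure.restrict_apply hm, ← Real.volume_Ioc]
    congr 1
    ext q
    simp only [mem_inter_iff, mem_Ioc, mem_ofPred_eq]
    exact ⟨fun h => ⟨h, (h0 t).trans_lt h.1, h.2.trans (h1 x)⟩, fun h => h.1⟩
  have inner : ∀ x, ∫⁻ t in Ioi 0, ENNReal.ofReal (D x - D t) =
      ∫⁻ q in Ioc 0 1, {q | q ≤ D x}.indicator v q := by
    intro x
    simp_rw [layer]
    rw [lintegral_lintegral_swap]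
    · refine lintegral_congr fun q => ?_
      by_cases hq : q ≤ D x
      · rw [indicator_of_mem (show q ∈ {q | q ≤ D x} from hq)]
        simp only [hv]
        rw [← lintegral_indicator_one (measurableSet_lt hDm measurable_const)]
        refine lintegral_congr fun t => ?_
        simp [indicator, hq]
      · simp [indicator, hq]
    · refine Measurable.aemeasurable ?_
      have : MeasurableSet {p : ℝ × ℝ | D p.1 < p.2 ∧ p.2 ≤ D x} :=
        (measurableSet_lt (hDm.comp measurable_fst) measurable_snd).inter
          (measurableSet_le measurable_snd measurable_const)
      exact (measurable_one.indicator this : Measurable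
        ({p : ℝ × ℝ | D p.1 < p.2 ∧ p.2 ≤ D x}.indicator (1 : ℝ × ℝ → ENNReal)))
  rw [lintegral_congr inner, lintegral_lintegral_swap]
  · calc ∫⁻ q in Ioc (0 : ℝ) 1, ∫⁻ x, {q | q ≤ D x}.indicator v q ∂μ
        ≤ ∫⁻ _ in Ioc (0 : ℝ) 1, R := by
          refine lintegral_mono fun q => ?_
          have hm : MeasurableSet {x | q ≤ D x} := measurableSet_le measurable_const hDm
          have : ∀ x, {q | q ≤ D x}.indicator v q = {x | q ≤ D x}.indicator (fun _ => v q) x :=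
            fun x => by simp [indicator]
          rw [lintegral_congr this, lintegral_indicator_const hm]
          have hle : ∀ x, q ≤ D x → v q ≤ ENNReal.ofReal x := by
            intro x hx
            have hm' : MeasurableSet {t | D t < q} := measurableSet_lt hDm measurable_const
            calc v q = volume ({t | D t < q} ∩ Ioi 0) := Measure.restrict_apply hm'
              _ ≤ volume (Ioo 0 x) := measure_mono fun t ht =>
                  ⟨ht.2, not_le.1 fun h => (ht.1.trans_le hx).not_ge (hD h)⟩
              _ = ENNReal.ofReal x := by simp
          rcases {x | q ≤ D x}.eq_empty_or_nonempty with he | ⟨x₀, hx₀⟩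
          · simp [he]
          · have hfin : v q ≠ ⊤ := ((hle x₀ hx₀).trans_lt ENNReal.ofReal_lt_top).ne
            refine le_trans ?_ (hR (v q).toReal ENNReal.toReal_nonneg)
            rw [ENNReal.ofReal_toReal hfin]
            refine mul_le_mul' le_rfl (measure_mono_ae ?_)
            filter_upwards [hμ] with x hx0 hx
            exact ENNReal.toReal_le_of_le_ofReal hx0 (hle x hx)
      _ = R := by simp
  · refine Measurable.aemeasurable ?_
    have : MeasurableSet {p : ℝ × ℝ | p.2 ≤ D p.1} :=
      measurableSet_le measurable_snd (hDm.comp measurable_fst)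
    exact ((hvm.comp measurable_snd).indicator this : Measurable
      ({p : ℝ × ℝ | p.2 ≤ D p.1}.indicator (fun p : ℝ × ℝ => v p.2)))

theorem integral_le_of_ofReal_le_lintegral {α : Type*} [MeasurableSpace α] (μ : Measure α)
    {φ : α → ℝ} {r : ℝ} (hr : 0 ≤ r) (h : ∫⁻ x, ENNReal.ofReal (φ x) ∂μ ≤ ENNReal.ofReal r) :
    ∫ x, φ x ∂μ ≤ r := by
  by_cases hφ : Integrable φ μ
  · rw [integral_eq_lintegral_pos_part_sub_lintegral_neg_part hφ]
    have h1 := ENNReal.toReal_le_of_le_ofReal hr h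
    have h2 : 0 ≤ (∫⁻ x, ENNReal.ofReal (-φ x) ∂μ).toReal := ENNReal.toReal_nonneg
    linarith
  · rwa [integral_undef hφ]

/-- Single-item payments, given through a convex utility `g`, earn no more than the best posted
price. -/
theorem integral_payment_le (μ : Measure ℝ) [SFinite μ] {a b : ℝ} (ha : 0 ≤ a)
    (hμ : ∀ᵐ x ∂μ, x ∈ Ioo a b) {r : ℝ} (hr : 0 ≤ r)
    (hR : ∀ t, 0 ≤ t → ENNReal.ofReal t * μ (Ici t) ≤ ENNReal.ofReal r) {g : ℝ → ℝ}
    (hg : ConvexOn ℝ (Icc a b) g) (hg0 : ∀ x ∈ Icc a b, 0 ≤ g x)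
    (hinc : ∀ x x', a ≤ x → x ≤ x' → x' ≤ b → 0 ≤ g x' - g x ∧ g x' - g x ≤ x' - x) {φ : ℝ → ℝ}
    (hφ : ∀ x ∈ Ioo a b, φ x ≤ max 0 (x * derivWithin g (Ioi x) x - g x)) :
    ∫ x, φ x ∂μ ≤ r := by
  set G : ℝ → ℝ := fun x => derivWithin g (Ioi x) x with hG
  have hint : ∀ {x}, x ∈ Ioo a b → x ∈ interior (Icc a b) := fun h => by rwa [interior_Icc]
  have hG0 : ∀ x ∈ Ioo a b, 0 ≤ G x := by
    intro x hx
    simp only [hG]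
    rw [hg.rightDeriv_eq_sInf_slope_of_mem_interior (hint hx)]
    refine Real.sInf_nonneg ?_
    rintro _ ⟨y, ⟨hy, hxy⟩, rfl⟩
    rw [slope_def_field]
    exact div_nonneg (hinc x y hx.1.le hxy.le hy.2).1 (sub_nonneg.2 hxy.le)
  have hG1 : ∀ x ∈ Ioo a b, G x ≤ 1 := by
    intro x hx
    refine (hg.rightDeriv_le_slope_of_mem_interior (hint hx)
      (right_mem_Icc.2 (hx.1.trans hx.2).le) hx.2).trans ?_
    rw [slope_def_field]
    exact div_le_one_of_le₀ (hinc x b hx.1.le hx.2.le le_rfl).2 (sub_nonneg.2 hx.2.le)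
  have hGm : MonotoneOn G (Ioo a b) := by
    have := hg.monotoneOn_rightDeriv
    rwa [interior_Icc] at this
  set D : ℝ → ℝ := fun x => if x ≤ a then 0 else if x < b then G x else 1 with hDdef
  have hDG : ∀ x ∈ Ioo a b, D x = G x := fun x hx => by simp [hDdef, hx.1.not_ge, hx.2]
  have hD0 : ∀ x, 0 ≤ D x := by
    intro x
    simp only [hDdef]
    split_ifs with h h'
    exacts [le_rfl, hG0 x ⟨not_le.1 h, h'⟩, zero_le_one]
  have hD1 : ∀ x, D x ≤ 1 := by
    intro x
    simp only [hDdef]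
    split_ifs with h h'
    exacts [zero_le_one, hG1 x ⟨not_le.1 h, h'⟩, le_rfl]
  have hD : Monotone D := by
    intro x y hxy
    by_cases hx : x ≤ a
    · simpa [hDdef, hx] using hD0 y
    by_cases hy : y < b
    · rw [hDG x ⟨not_le.1 hx, hxy.trans_lt hy⟩, hDG y ⟨(not_le.1 hx).trans_le hxy, hy⟩]
      exact hGm ⟨not_le.1 hx, hxy.trans_lt hy⟩ ⟨(not_le.1 hx).trans_le hxy, hy⟩ hxy
    · have : D y = 1 := by simp [hDdef, ((not_le.1 hx).trans_le hxy).not_ge, hy]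
      rw [this]
      exact hD1 x
  have hDi : ∀ c d, IntervalIntegrable D volume c d := fun c d => hD.intervalIntegrable
  have hcont : ContinuousOn g (Icc a b) := by
    have : LipschitzOnWith 1 g (Icc a b) := by
      refine LipschitzOnWith.of_le_add fun x hx y hy => ?_
      rcases le_total x y with h | h
      · have := (hinc x y hx.1 h hy.2).1
        linarith [dist_nonneg (x := x) (y := y)]
      · have := (hinc y x hy.1 h hx.2).2
        rw [Real.dist_eq, abs_of_nonneg (sub_nonneg.2 h)]
        linarith
    exact this.continuousOn
  have hFTC : ∀ x ∈ Ioo a b, ∫ t in (0 : ℝ)..x, D t = g x - g a := by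
    intro x hx
    rw [← intervalIntegral.integral_add_adjacent_intervals (hDi 0 a) (hDi a x)]
    have e1 : ∫ t in (0 : ℝ)..a, D t = 0 := by
      rw [intervalIntegral.integral_congr (g := fun _ => 0)]
      · simp
      · intro t ht
        rw [uIcc_of_le ha] at ht
        simp [hDdef, ht.2]
    rw [e1, zero_add]
    refine intervalIntegral.integral_eq_sub_of_hasDeriv_right ?_ ?_ (hDi a x)
    · rw [uIcc_of_le hx.1.le]
      exact hcont.mono (Icc_subset_Icc_right hx.2.le)
    · intro t ht
      rw [min_eq_left hx.1.le, max_eq_right hx.1.le] at ht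
      have ht' : t ∈ Ioo a b := ⟨ht.1, ht.2.trans hx.2⟩
      rw [hDG t ht']
      exact hg.hasDerivWithinAt_rightDeriv_of_mem_interior (hint ht')
  refine integral_le_of_ofReal_le_lintegral μ hr (le_trans ?_
    (lintegral_sub_le_of_monotone μ hD hD0 hD1 (hμ.mono fun x hx => ha.trans hx.1.le) hR))
  refine lintegral_mono_ae (hμ.mono fun x hx => ?_)
  have hx0 : 0 ≤ x := ha.trans hx.1.le
  have hsub : ∫ t in (0 : ℝ)..x, (D x - D t) = x * D x - (g x - g a) := by
    rw [intervalIntegral.integral_sub intervalIntegrable_const (hDi 0 x), hFTC x hx]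
    simp
  have hpos : 0 ≤ ∫ t in (0 : ℝ)..x, (D x - D t) :=
    intervalIntegral.integral_nonneg hx0 fun t ht => sub_nonneg.2 (hD ht.2)
  have hle : φ x ≤ ∫ t in (0 : ℝ)..x, (D x - D t) := by
    refine (hφ x hx).trans (max_le hpos ?_)
    rw [hsub, hDG x hx]
    linarith [hg0 a ⟨le_rfl, (hx.1.trans hx.2).le⟩]
  refine (ENNReal.ofReal_le_ofReal hle).trans ?_
  rw [intervalIntegral.integral_of_le hx0, ofReal_integral_eq_lintegral_ofReal]
  · exact lintegral_mono_set fun t ht => ht.1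
  · exact ((intervalIntegrable_const).sub (hDi 0 x)).1
  · filter_upwards [ae_restrict_mem measurableSet_Ioc] with t ht
    exact sub_nonneg.2 (hD ht.2)

/-- Tail formula for the mean of the minimum of two independent nonnegative variables. -/
theorem lintegral_min_prod (μ ν : Measure ℝ) [SFinite μ] [SFinite ν] (hμ : ∀ᵐ x ∂μ, 0 ≤ x)
    (hν : ∀ᵐ x ∂ν, 0 ≤ x) :
    ∫⁻ z, ENNReal.ofReal (min z.1 z.2) ∂(μ.prod ν) = ∫⁻ t in Ioi 0, μ (Ici t) * ν (Ici t) := by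
  rw [lintegral_eq_lintegral_meas_le]
  · refine lintegral_congr fun t => ?_
    rw [← Measure.prod_prod]
    congr 1
    ext z
    exact le_min_iff (a := z.1) (b := z.2) (c := t)
  · filter_upwards [Measure.quasiMeasurePreserving_fst.ae hμ,
      Measure.quasiMeasurePreserving_snd.ae hν] with z h1 h2
    exact le_min h1 h2
  · fun_prop

theorem ENNReal.two_mul_mul_le_add_mul_self {a b : ENNReal} (ha : a ≠ ⊤) (hb : b ≠ ⊤) :
    2 * (a * b) ≤ a * a + b * b := by
  lift a to NNReal using ha
  lift b to NNReal using hb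
  norm_cast
  have := two_mul_le_add_sq a b
  rwa [mul_assoc, sq, sq] at this

/-- The mean of the minimum of two independent values is at most the bundling revenue. -/
theorem lintegral_min_le (μ ν : Measure ℝ) [IsProbabilityMeasure μ] [IsProbabilityMeasure ν]
    (hμ : ∀ᵐ x ∂μ, 0 ≤ x) (hν : ∀ᵐ x ∂ν, 0 ≤ x) {R : ENNReal}
    (hR : ∀ t, 0 ≤ t → ENNReal.ofReal t * (μ.prod ν) {z | t ≤ z.1 + z.2} ≤ R) :
    ∫⁻ z, ENNReal.ofReal (min z.1 z.2) ∂(μ.prod ν) ≤ R := by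
  set π := μ.prod ν with hπ
  have hπ0 : ∀ᵐ z ∂π, 0 ≤ z.1 ∧ 0 ≤ z.2 :=
    (Measure.quasiMeasurePreserving_fst.ae hμ).and (Measure.quasiMeasurePreserving_snd.ae hν)
  set K : ℝ × ℝ → ℝ × ℝ → ENNReal := fun w z =>
    if w.1 + w.2 ≤ z.1 + z.2 then ENNReal.ofReal (w.1 + w.2) else 0 with hK
  have hKm : Measurable (Function.uncurry K) :=
    Measurable.ite (measurableSet_le (by fun_prop) (by fun_prop)) (by fun_prop) measurable_const
  have hsell : ∫⁻ w, ∫⁻ z, K w z ∂π ∂π ≤ R := by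
    calc _ ≤ ∫⁻ _, R ∂π := by
          refine lintegral_mono_ae (hπ0.mono fun w hw => ?_)
          have : ∀ z, K w z = {z : ℝ × ℝ | w.1 + w.2 ≤ z.1 + z.2}.indicator
              (fun _ => ENNReal.ofReal (w.1 + w.2)) z := fun z => by simp [hK, indicator]
          rw [lintegral_congr this,
            lintegral_indicator_const (measurableSet_le measurable_const (by fun_prop))]
          exact hR _ (add_nonneg hw.1 hw.2)
      _ = R := by simp
  have hsell' : ∫⁻ w, ∫⁻ z, K z w ∂π ∂π ≤ R := by
    rwa [lintegral_lintegral_swap (f := fun w z => K z w) (hKm.comp measurable_swap).aemeasurable]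
  have hsplit : ∫⁻ w, ∫⁻ z, (ENNReal.ofReal (min w.1 z.1) + ENNReal.ofReal (min w.2 z.2)) ∂π ∂π
      ≤ R + R := by
    refine le_trans ?_ (add_le_add hsell hsell')
    have hKi : Measurable fun w => ∫⁻ z, K w z ∂π := hKm.lintegral_prod_right'
    rw [← lintegral_add_left hKi]
    refine lintegral_mono_ae (hπ0.mono fun w hw => ?_)
    refine le_trans ?_ (lintegral_add_left (hKm.comp measurable_prodMk_left) _).le
    refine lintegral_mono_ae (hπ0.mono fun z hz => ?_)
    rw [← ENNReal.ofReal_add (le_min hw.1 hz.1) (le_min hw.2 hz.2)]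
    rcases le_total (w.1 + w.2) (z.1 + z.2) with h | h
    · refine le_trans ?_ le_self_add
      simp only [hK, Function.comp, Function.uncurry, if_pos h]
      exact ENNReal.ofReal_le_ofReal (add_le_add (min_le_left _ _) (min_le_left _ _))
    · refine le_trans ?_ le_add_self
      simp only [hK, if_pos h]
      exact ENNReal.ofReal_le_ofReal (add_le_add (min_le_right _ _) (min_le_right _ _))
  have hself : ∫⁻ w, ∫⁻ z, (ENNReal.ofReal (min w.1 z.1) + ENNReal.ofReal (min w.2 z.2)) ∂π ∂π
      = ∫⁻ p, ENNReal.ofReal (min p.1 p.2) ∂(μ.prod μ)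
        + ∫⁻ p, ENNReal.ofReal (min p.1 p.2) ∂(ν.prod ν) := by
    have hm : Measurable fun p : ℝ × ℝ => ENNReal.ofReal (min p.1 p.2) := by fun_prop
    have h1 : ∀ w : ℝ × ℝ, ∫⁻ z, ENNReal.ofReal (min w.1 z.1) ∂π =
        ∫⁻ x, ENNReal.ofReal (min w.1 x) ∂μ := fun w =>
      measurePreserving_fst.lintegral_comp (f := fun x => ENNReal.ofReal (min w.1 x))
        (by fun_prop)
    have h2 : ∀ w : ℝ × ℝ, ∫⁻ z, ENNReal.ofReal (min w.2 z.2) ∂π =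
        ∫⁻ x, ENNReal.ofReal (min w.2 x) ∂ν := fun w =>
      measurePreserving_snd.lintegral_comp (f := fun x => ENNReal.ofReal (min w.2 x))
        (by fun_prop)
    have h3 : ∀ w : ℝ × ℝ,
        ∫⁻ z, (ENNReal.ofReal (min w.1 z.1) + ENNReal.ofReal (min w.2 z.2)) ∂π =
        ∫⁻ x, ENNReal.ofReal (min w.1 x) ∂μ + ∫⁻ x, ENNReal.ofReal (min w.2 x) ∂ν := fun w => by
      rw [lintegral_add_left (by fun_prop), h1, h2]
    have hm1 : Measurable fun t => ∫⁻ x, ENNReal.ofReal (min t x) ∂μ := hm.lintegral_prod_right'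
    have hm2 : Measurable fun t => ∫⁻ x, ENNReal.ofReal (min t x) ∂ν := hm.lintegral_prod_right'
    have hm1' : Measurable fun w : ℝ × ℝ => ∫⁻ x, ENNReal.ofReal (min w.1 x) ∂μ :=
      hm1.comp measurable_fst
    rw [lintegral_congr h3, lintegral_add_left hm1',
      measurePreserving_fst.lintegral_comp hm1, measurePreserving_snd.lintegral_comp hm2,
      lintegral_prod _ hm.aemeasurable, lintegral_prod _ hm.aemeasurable]
  have hAG : 2 * ∫⁻ z, ENNReal.ofReal (min z.1 z.2) ∂π ≤
      ∫⁻ p, ENNReal.ofReal (min p.1 p.2) ∂(μ.prod μ)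
        + ∫⁻ p, ENNReal.ofReal (min p.1 p.2) ∂(ν.prod ν) := by
    have hanti : ∀ ρ : Measure ℝ, Measurable fun t => ρ (Ici t) := fun ρ =>
      Antitone.measurable fun s t hst => measure_mono (Ici_subset_Ici.2 hst)
    have hmul : ∀ ρ ρ' : Measure ℝ, Measurable fun t => ρ (Ici t) * ρ' (Ici t) := fun ρ ρ' =>
      (hanti ρ).mul (hanti ρ')
    rw [hπ, lintegral_min_prod μ ν hμ hν, lintegral_min_prod μ μ hμ hμ,
      lintegral_min_prod ν ν hν hν, ← lintegral_add_left (hmul μ μ),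
      ← lintegral_const_mul _ (hmul μ ν)]
    exact lintegral_mono fun t =>
      ENNReal.two_mul_mul_le_add_mul_self (measure_ne_top _ _) (measure_ne_top _ _)
  have h2 := hAG.trans (hself ▸ hsplit)
  rw [← two_mul] at h2
  exact (ENNReal.mul_le_mul_iff_right (by norm_num) (by norm_num)).1 h2

theorem Density.measurable_indicator {a b : ℝ} {f : ℝ → ℝ} (hf : Density a b f) :
    Measurable ((Icc a b).indicator f) := by
  rw [← piecewise_eq_indicator]
  exact ContinuousOn.measurable_piecewise
    (fun x hx => (hf.2.2.1 x hx).continuousAt.continuousWithinAt) continuousOn_const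
    measurableSet_Icc

theorem Density.indicator_nonneg {a b : ℝ} {f : ℝ → ℝ} (hf : Density a b f) (x : ℝ) :
    0 ≤ (Icc a b).indicator f x :=
  Set.indicator_nonneg (fun x hx => (hf.1 x hx).le) x

/-- The probability measure on `ℝ` with density `f` on `[a,b]`. -/
def densityLaw (a b : ℝ) (f : ℝ → ℝ) : Measure ℝ :=
  volume.withDensity fun x => ENNReal.ofReal ((Icc a b).indicator f x)

instance (a b : ℝ) (f : ℝ → ℝ) : SFinite (densityLaw a b f) := by
  unfold densityLaw
  infer_instance

theorem Density.isProbabilityMeasure {a b : ℝ} {f : ℝ → ℝ} (hab : a ≤ b) (hf : Density a b f) :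
    IsProbabilityMeasure (densityLaw a b f) := by
  constructor
  have hint : IntegrableOn f (Icc a b) :=
    ContinuousOn.integrableOn_Icc fun x hx => (hf.2.2.1 x hx).continuousAt.continuousWithinAt
  rw [densityLaw, withDensity_apply _ MeasurableSet.univ, Measure.restrict_univ,
    ← ofReal_integral_eq_lintegral_ofReal (hint.integrable_indicator measurableSet_Icc)
      (Filter.Eventually.of_forall hf.indicator_nonneg),
    integral_indicator measurableSet_Icc, integral_Icc_eq_integral_Ioc,
    ← intervalIntegral.integral_of_le hab, hf.2.2.2, ENNReal.ofReal_one]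

theorem Density.ae_mem_Ioo {a b : ℝ} {f : ℝ → ℝ} (hf : Density a b f) :
    ∀ᵐ x ∂(densityLaw a b f), x ∈ Ioo a b := by
  have h1 : ∀ᵐ x ∂(densityLaw a b f), x ∈ Icc a b := by
    rw [densityLaw, ae_withDensity_iff hf.measurable_indicator.ennreal_ofReal]
    refine Filter.Eventually.of_forall fun x hx => ?_
    by_contra h
    exact hx (by rw [indicator_of_notMem h, ENNReal.ofReal_zero])
  have hac : densityLaw a b f ≪ volume := withDensity_absolutelyContinuous _ _
  filter_upwards [h1, hac.ae_le (Measure.ae_ne volume a), hac.ae_le (Measure.ae_ne volume b)]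
    with x hx ha hb
  exact ⟨lt_of_le_of_ne hx.1 (Ne.symm ha), lt_of_le_of_ne hx.2 hb⟩

theorem V_eq_prod (xA xB yA yC : ℝ) : V xA xB yA yC = Icc xA xB ×ˢ Icc yA yC :=
  Icc_prod_eq _ _

theorem measurableSet_V (xA xB yA yC : ℝ) : MeasurableSet (V xA xB yA yC) := by
  rw [V_eq_prod]
  exact measurableSet_Icc.prod measurableSet_Icc

theorem setIntegral_V_eq {xA xB yA yC : ℝ} {f1 f2 : ℝ → ℝ} (hf1 : Density xA xB f1)
    (hf2 : Density yA yC f2) (F : ℝ × ℝ → ℝ) :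
    ∫ z in V xA xB yA yC, F z * (f1 z.1 * f2 z.2) =
      ∫ z, F z ∂((densityLaw xA xB f1).prod (densityLaw yA yC f2)) := by
  have hm1 := hf1.measurable_indicator.ennreal_ofReal
  have hm2 := hf2.measurable_indicator.ennreal_ofReal
  rw [densityLaw, densityLaw, prod_withDensity hm1 hm2, ← Measure.volume_eq_prod,
    integral_withDensity_eq_integral_toReal_smul
      (f := fun z : ℝ × ℝ => ENNReal.ofReal ((Icc xA xB).indicator f1 z.1) *
        ENNReal.ofReal ((Icc yA yC).indicator f2 z.2))
      ((hm1.comp measurable_fst).mul (hm2.comp measurable_snd))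
      (Filter.Eventually.of_forall fun z => ENNReal.mul_lt_top ENNReal.ofReal_lt_top
        ENNReal.ofReal_lt_top),
    ← integral_indicator (measurableSet_V _ _ _ _)]
  refine integral_congr_ae (Filter.Eventually.of_forall fun z => ?_)
  simp only [ENNReal.toReal_mul, ENNReal.toReal_ofReal (hf1.indicator_nonneg _),
    ENNReal.toReal_ofReal (hf2.indicator_nonneg _), smul_eq_mul]
  rw [V_eq_prod]
  by_cases hz1 : z.1 ∈ Icc xA xB
  · by_cases hz2 : z.2 ∈ Icc yA yC
    · rw [indicator_of_mem (show z ∈ Icc xA xB ×ˢ Icc yA yC from ⟨hz1, hz2⟩),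
        indicator_of_mem hz1, indicator_of_mem hz2, mul_comm]
    · rw [indicator_of_notMem (fun h => hz2 h.2), indicator_of_notMem hz2, mul_zero, zero_mul]
  · rw [indicator_of_notMem (fun h => hz1 h.1), indicator_of_notMem hz1, zero_mul, zero_mul]

theorem setIntegral_bundle_eq {xA xB yA yC : ℝ} {f1 f2 : ℝ → ℝ} (hf1 : Density xA xB f1)
    (hf2 : Density yA yC f2) (p : ℝ) :
    ∫ z in {z ∈ V xA xB yA yC | p ≤ z.1 + z.2}, f1 z.1 * f2 z.2 =
      ((densityLaw xA xB f1).prod (densityLaw yA yC f2)).real {z | p ≤ z.1 + z.2} := by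
  have hm : MeasurableSet {z : ℝ × ℝ | p ≤ z.1 + z.2} :=
    measurableSet_le measurable_const (by fun_prop)
  have hset : {z ∈ V xA xB yA yC | p ≤ z.1 + z.2} =
      V xA xB yA yC ∩ {z : ℝ × ℝ | p ≤ z.1 + z.2} := rfl
  rw [hset, ← setIntegral_indicator hm, ← integral_indicator_one hm, ← setIntegral_V_eq hf1 hf2]
  congr 1
  ext z
  by_cases hz : z ∈ {z : ℝ × ℝ | p ≤ z.1 + z.2}
  · simp only [indicator_of_mem hz, Pi.one_apply, one_mul]
  · simp only [indicator_of_notMem hz, zero_mul]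

theorem mul_measure_le_BRev {xA xB yA yC : ℝ} (h1 : xA < xB) (h3 : yA < yC) {f1 f2 : ℝ → ℝ}
    (hf1 : Density xA xB f1) (hf2 : Density yA yC f2) {p : ℝ} (hp : 0 ≤ p) :
    ENNReal.ofReal p * ((densityLaw xA xB f1).prod (densityLaw yA yC f2)) {z | p ≤ z.1 + z.2} ≤
      ENNReal.ofReal (BRev xA xB yA yC f1 f2) := by
  have := hf1.isProbabilityMeasure h1.le
  have := hf2.isProbabilityMeasure h3.le
  set π := (densityLaw xA xB f1).prod (densityLaw yA yC f2) with hπ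
  have hbdd : BddAbove {r | ∃ p, 0 ≤ p ∧
      r = p * ∫ z in {z ∈ V xA xB yA yC | p ≤ z.1 + z.2}, f1 z.1 * f2 z.2} := by
    refine ⟨|xB + yC|, ?_⟩
    rintro _ ⟨q, hq, rfl⟩
    rw [setIntegral_bundle_eq hf1 hf2]
    rcases le_or_gt q (xB + yC) with h | h
    · calc q * π.real {z | q ≤ z.1 + z.2} ≤ q * 1 :=
            mul_le_mul_of_nonneg_left measureReal_le_one hq
        _ ≤ |xB + yC| := by rw [mul_one]; exact h.trans (le_abs_self _)
    · have hz : π.real {z | q ≤ z.1 + z.2} = 0 := by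
        have : π {z | q ≤ z.1 + z.2} = 0 := by
          rw [measure_eq_zero_iff_ae_notMem]
          filter_upwards [Measure.quasiMeasurePreserving_fst.ae hf1.ae_mem_Ioo,
            Measure.quasiMeasurePreserving_snd.ae hf2.ae_mem_Ioo] with z hz1 hz2 hz
          have hz' : q ≤ z.1 + z.2 := hz
          linarith [hz1.2, hz2.2]
        simp [measureReal_def, this]
      rw [← hπ, hz, mul_zero]
      exact abs_nonneg _
  have hle : p * π.real {z | p ≤ z.1 + z.2} ≤ BRev xA xB yA yC f1 f2 :=
    le_csSup hbdd ⟨p, hp, by rw [setIntegral_bundle_eq hf1 hf2]⟩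
  calc _ = ENNReal.ofReal (p * π.real {z | p ≤ z.1 + z.2}) := by
        rw [ENNReal.ofReal_mul hp, ofReal_measureReal]
    _ ≤ _ := ENNReal.ofReal_le_ofReal hle

theorem BRev_nonneg {xA xB yA yC : ℝ} {f1 f2 : ℝ → ℝ} (hf1 : Density xA xB f1)
    (hf2 : Density yA yC f2) : 0 ≤ BRev xA xB yA yC f1 f2 := by
  refine Real.sSup_nonneg ?_
  rintro _ ⟨p, hp, rfl⟩
  rw [setIntegral_bundle_eq hf1 hf2]
  exact mul_nonneg hp measureReal_nonneg

theorem hasDerivAt_fst_of_differentiableAt {u : ℝ × ℝ → ℝ} {x y : ℝ}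
    (hu : DifferentiableAt ℝ u (x, y)) : HasDerivAt (fun t => u (t, y)) (pd1 u (x, y)) x :=
  hu.hasFDerivAt.comp_hasDerivAt x ((hasDerivAt_id x).prodMk (hasDerivAt_const x y))

theorem hasDerivAt_snd_of_differentiableAt {u : ℝ × ℝ → ℝ} {x y : ℝ}
    (hu : DifferentiableAt ℝ u (x, y)) : HasDerivAt (fun t => u (x, t)) (pd2 u (x, y)) y :=
  hu.hasFDerivAt.comp_hasDerivAt y ((hasDerivAt_const y x).prodMk (hasDerivAt_id y))

theorem HasDerivAt.le_one_of_increments {g : ℝ → ℝ} {g' a b x : ℝ} (hg : HasDerivAt g g' x)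
    (hx : x ∈ Ioo a b) (hinc : ∀ x x', a ≤ x → x ≤ x' → x' ≤ b → g x' - g x ≤ x' - x) :
    g' ≤ 1 := by
  have hmono : MonotoneOn (fun t => t - g t) (Ioo a b) := fun s hs t ht hst => by
    linarith [hinc s t hs.1.le hst ht.2.le]
  have hd : HasDerivAt (fun t => t - g t) (1 - g') x := (hasDerivAt_id x).sub hg
  have := (hd.hasDerivWithinAt (s := Ioo a b)).nonneg_of_monotoneOn
    (isOpen_Ioo.uniqueDiffWithinAt (𝕜 := ℝ) hx).accPt hmono
  linarith

theorem Rev_le {xA xB yA yC : ℝ} (h0 : 0 ≤ xA) (h1 : xA < xB) (h2 : 0 ≤ yA) (h3 : yA < yC)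
    {f1 f2 : ℝ → ℝ} (hf1 : Density xA xB f1) (hf2 : Density yA yC f2) {u : ℝ × ℝ → ℝ}
    (hu : Feasible xA xB yA yC u) :
    Rev xA xB yA yC f1 f2 u ≤ 3 * BRev xA xB yA yC f1 f2 := by
  obtain ⟨hu0, huc, hu1, hu2⟩ := hu
  set r := BRev xA xB yA yC f1 f2 with hr
  have hr0 : 0 ≤ r := BRev_nonneg hf1 hf2
  have hP1 := hf1.isProbabilityMeasure h1.le
  have hP2 := hf2.isProbabilityMeasure h3.le
  set μ := densityLaw xA xB f1 with hμ
  set ν := densityLaw yA yC f2 with hν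
  have hμI : ∀ᵐ x ∂μ, x ∈ Ioo xA xB := hf1.ae_mem_Ioo
  have hνI : ∀ᵐ y ∂ν, y ∈ Ioo yA yC := hf2.ae_mem_Ioo
  have hμ0 : ∀ᵐ x ∂μ, 0 ≤ x := hμI.mono fun x hx => h0.trans hx.1.le
  have hν0 : ∀ᵐ y ∂ν, 0 ≤ y := hνI.mono fun y hy => h2.trans hy.1.le
  have hR : ∀ t, 0 ≤ t → ENNReal.ofReal t * (μ.prod ν) {z | t ≤ z.1 + z.2} ≤ ENNReal.ofReal r :=
    fun t ht => mul_measure_le_BRev h1 h3 hf1 hf2 ht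
  have hRμ : ∀ t, 0 ≤ t → ENNReal.ofReal t * μ (Ici t) ≤ ENNReal.ofReal r := by
    intro t ht
    refine le_trans (mul_le_mul' le_rfl ?_) (hR t ht)
    rw [← (measurePreserving_fst (μ := μ) (ν := ν)).measure_preimage
      measurableSet_Ici.nullMeasurableSet]
    refine measure_mono_ae ?_
    filter_upwards [Measure.quasiMeasurePreserving_snd.ae hν0] with z hz (hzt : t ≤ z.1)
    exact hzt.trans (le_add_of_nonneg_right hz)
  have hRν : ∀ t, 0 ≤ t → ENNReal.ofReal t * ν (Ici t) ≤ ENNReal.ofReal r := by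
    intro t ht
    refine le_trans (mul_le_mul' le_rfl ?_) (hR t ht)
    rw [← (measurePreserving_snd (μ := μ) (ν := ν)).measure_preimage
      measurableSet_Ici.nullMeasurableSet]
    refine measure_mono_ae ?_
    filter_upwards [Measure.quasiMeasurePreserving_fst.ae hμ0] with z hz (hzt : t ≤ z.2)
    exact hzt.trans (le_add_of_nonneg_left hz)
  rw [Rev, setIntegral_V_eq hf1 hf2]
  set F : ℝ × ℝ → ℝ := fun z => z.1 * pd1 u z + z.2 * pd2 u z - u z with hF
  by_cases hFi : Integrable F (μ.prod ν)
  swap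
  · rw [integral_undef hFi]
    positivity
  set s : Set (ℝ × ℝ) := {z | z.2 ≤ z.1} with hs
  have hsm : MeasurableSet s := measurableSet_le measurable_snd measurable_fst
  have hmem : ∀ {x y}, x ∈ Ioo xA xB → y ∈ Ioo yA yC → (x, y) ∈ V xA xB yA yC := by
    intro x y hx hy
    rw [V_eq_prod]
    exact ⟨Ioo_subset_Icc_self hx, Ioo_subset_Icc_self hy⟩
  have hpd : ∀ x ∈ Ioo xA xB, ∀ y ∈ Ioo yA yC,
      pd1 u (x, y) ≤ 1 ∧ pd2 u (x, y) ≤ 1 := by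
    intro x hx y hy
    by_cases hd : DifferentiableAt ℝ u (x, y)
    · exact ⟨(hasDerivAt_fst_of_differentiableAt hd).le_one_of_increments hx fun s t a b c =>
          (hu1 s t y a b c (Ioo_subset_Icc_self hy)).2,
        (hasDerivAt_snd_of_differentiableAt hd).le_one_of_increments hy fun s t a b c =>
          (hu2 x s t (Ioo_subset_Icc_self hx) a b c).2⟩
    · simp [pd1, pd2, fderiv_zero_of_not_differentiableAt hd]
  have hmini : Integrable (fun z : ℝ × ℝ => min z.1 z.2) (μ.prod ν) := by
    refine Integrable.of_bound (C := xB) (by fun_prop) ?_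
    filter_upwards [Measure.quasiMeasurePreserving_fst.ae hμI,
      Measure.quasiMeasurePreserving_snd.ae hνI] with z hz1 hz2
    rw [Real.norm_of_nonneg (le_min (h0.trans hz1.1.le) (h2.trans hz2.1.le))]
    exact (min_le_left _ _).trans hz1.2.le
  have hmin : ∫ z, min z.1 z.2 ∂(μ.prod ν) ≤ r :=
    integral_le_of_ofReal_le_lintegral _ hr0 (lintegral_min_le μ ν hμ0 hν0 hR)
  set W := fun z => F z - min z.1 z.2 with hW
  have hWi : Integrable W (μ.prod ν) := hFi.sub hmini
  have hsplit : ∫ z, F z ∂(μ.prod ν) = ∫ z, s.indicator W z ∂(μ.prod ν)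
      + ∫ z, sᶜ.indicator W z ∂(μ.prod ν) + ∫ z, min z.1 z.2 ∂(μ.prod ν) := by
    rw [integral_indicator hsm, integral_indicator hsm.compl, integral_add_compl hsm hWi,
      ← integral_add hWi hmini]
    simp [hW]
  have hA : ∫ z, s.indicator W z ∂(μ.prod ν) ≤ r := by
    have hi := hWi.indicator hsm
    rw [integral_prod_symm _ hi]
    calc _ ≤ ∫ _, r ∂ν := by
          refine integral_mono_ae hi.integral_prod_right (integrable_const r) ?_
          filter_upwards [hνI] with y hy
          have hy' := Ioo_subset_Icc_self hy
          refine integral_payment_le μ h0 hμI hr0 hRμ (g := fun t => u (t, y)) ?_ ?_ ?_ ?_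
          · refine ⟨convex_Icc _ _, fun x hx x' hx' a b ha hb hab => ?_⟩
            have := huc.2 (x := (x, y)) (y := (x', y)) (by rw [V_eq_prod]; exact ⟨hx, hy'⟩)
              (by rw [V_eq_prod]; exact ⟨hx', hy'⟩) ha hb hab
            simpa [← add_mul, hab] using this
          · exact fun x hx => hu0 _ (by rw [V_eq_prod]; exact ⟨hx, hy'⟩)
          · exact fun x x' a b c => hu1 x x' y a b c hy'
          · intro x hx
            by_cases hxy : y ≤ x
            swap
            · rw [indicator_of_notMem (show (x, y) ∉ s from hxy)]
              exact le_max_left _ _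
            rw [indicator_of_mem (show (x, y) ∈ s from hxy)]
            simp only [hW, hF, min_eq_right hxy]
            have hy0 : 0 ≤ y := h2.trans hy.1.le
            have hp := mul_le_mul_of_nonneg_left (hpd x hx y hy).2 hy0
            by_cases hd : DifferentiableAt ℝ u (x, y)
            · rw [(hasDerivAt_fst_of_differentiableAt hd).hasDerivWithinAt.derivWithin
                (uniqueDiffWithinAt_Ioi x)]
              exact le_max_of_le_right (by linarith)
            · refine le_max_of_le_left ?_
              have := hu0 _ (hmem hx hy)
              simp only [pd1, pd2, fderiv_zero_of_not_differentiableAt hd]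
              simp
              linarith
      _ = r := by simp
  have hB : ∫ z, sᶜ.indicator W z ∂(μ.prod ν) ≤ r := by
    have hi := hWi.indicator hsm.compl
    rw [integral_prod _ hi]
    calc _ ≤ ∫ _, r ∂μ := by
          refine integral_mono_ae hi.integral_prod_left (integrable_const r) ?_
          filter_upwards [hμI] with x hx
          have hx' := Ioo_subset_Icc_self hx
          refine integral_payment_le ν h2 hνI hr0 hRν (g := fun t => u (x, t)) ?_ ?_ ?_ ?_
          · refine ⟨convex_Icc _ _, fun y hy y' hy' a b ha hb hab => ?_⟩
            have := huc.2 (x := (x, y)) (y := (x, y')) (by rw [V_eq_prod]; exact ⟨hx', hy⟩)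
              (by rw [V_eq_prod]; exact ⟨hx', hy'⟩) ha hb hab
            simpa [← add_mul, hab] using this
          · exact fun y hy => hu0 _ (by rw [V_eq_prod]; exact ⟨hx', hy⟩)
          · exact fun y y' a b c => hu2 x y y' hx' a b c
          · intro y hy
            by_cases hxy : y ≤ x
            · rw [indicator_of_notMem (show (x, y) ∉ sᶜ from fun h => h hxy)]
              exact le_max_left _ _
            rw [indicator_of_mem (show (x, y) ∈ sᶜ from hxy)]
            simp only [hW, hF, min_eq_left (not_le.1 hxy).le]
            have hx0 : 0 ≤ x := h0.trans hx.1.le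
            have hp := mul_le_mul_of_nonneg_left (hpd x hx y hy).1 hx0
            by_cases hd : DifferentiableAt ℝ u (x, y)
            · rw [(hasDerivAt_snd_of_differentiableAt hd).hasDerivWithinAt.derivWithin
                (uniqueDiffWithinAt_Ioi y)]
              exact le_max_of_le_right (by linarith)
            · refine le_max_of_le_left ?_
              have := hu0 _ (hmem hx hy)
              simp only [pd1, pd2, fderiv_zero_of_not_differentiableAt hd]
              simp
              linarith
      _ = r := by simp
  linarith

/-- under Conditions 2 and 3, bundling 3-approximates optimal revenue. -/
theorem stmt13 (xA xB yA yC : ℝ) (h0 : 0 ≤ xA) (h1 : xA < xB) (h2 : 0 ≤ yA) (h3 : yA < yC)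
    (f1 f2 : ℝ → ℝ) (hf1 : Density xA xB f1) (hf2 : Density yA yC f2)
    (hC2 : ∀ x ∈ Set.Icc xA xB, ∀ y ∈ Set.Icc yA yC, -3 ≤ PR f1 x + PR f2 y)
    (hC3a : ∃ c1 : ℝ, ∀ x ∈ Set.Icc xA xB, PR f1 x = c1)
    (hC3b : ∃ c2 : ℝ, ∀ y ∈ Set.Icc yA yC, PR f2 y = c2) :
    OptRev xA xB yA yC f1 f2 ≤ 3 * BRev xA xB yA yC f1 f2 := by
  refine Real.sSup_le ?_ (mul_nonneg zero_le_three (BRev_nonneg hf1 hf2))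
  rintro _ ⟨u, hu, rfl⟩
  exact Rev_le h0 h1 h2 h3 hf1 hf2 hu
end
end
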